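/- arXiv:1807.04196 — 3 statements merged into one kernel-verified Lean document; each statement's English description precedes it below -/
import Mathlib

section
/- Every bridgeless cubic graph admits an (r, (6−r)/4)-flow for every real r with 2≤r≤6. -/
open Finset
open scoped Classical

namespace BEF

variable {V : Type*}

/-- An orientation of a simple graph: each edge gets exactly one direction. -/
structure Orientation (G : SimpleGraph V) where
  dir : V → V → Prop
  adj_of_dir : ∀ u v, dir u v → G.Adj u v
  dir_iff_not : ∀ u v, G.Adj u v → (dir u v ↔ ¬ dir v u)

/-- Net outflow (excess) of `f` at vertex `x` in orientation `D`. -/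
noncomputable def excess [Fintype V] {G : SimpleGraph V}
    (D : Orientation G) (f : Sym2 V → ℝ) (x : V) : ℝ :=
  (∑ y : V, if D.dir x y then f s(x, y) else 0)
    - (∑ y : V, if D.dir y x then f s(x, y) else 0)

/-- `f` is an `(r, α)`-bounded-excess flow in the orientation `D` of `G`. -/
def IsBEFlow [Fintype V] {G : SimpleGraph V}
    (D : Orientation G) (r α : ℝ) (f : Sym2 V → ℝ) : Prop :=
  (∀ e ∈ G.edgeSet, 1 ≤ f e ∧ f e ≤ r - 1) ∧ ∀ x : V, |excess D f x| ≤ α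

/-- `G` admits an `(r, α)`-flow. -/
def HasFlow [Fintype V] (G : SimpleGraph V) (r α : ℝ) : Prop :=
  ∃ D : Orientation G, ∃ f : Sym2 V → ℝ, IsBEFlow D r α f

/-- Outdegree of a vertex in an orientation. -/
noncomputable def outDeg {G : SimpleGraph V} (D : Orientation G) (x : V) : ℕ :=
  {y | D.dir x y}.ncard

/-- A cubic graph: every vertex has exactly 3 neighbours. -/
def IsCubic (G : SimpleGraph V) : Prop :=
  ∀ v : V, (G.neighborSet v).ncard = 3

/-- A bisection: a partition of the vertex set into two parts of equal size. -/
def IsBisection [Fintype V] (V₁ V₂ : Set V) : Prop :=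
  Disjoint V₁ V₂ ∧ V₁ ∪ V₂ = Set.univ ∧ V₁.ncard = V₂.ncard

/-- The bisection `(V₁, V₂)` of `G` is orientable. -/
def Orientable (G : SimpleGraph V) (V₁ V₂ : Set V) : Prop :=
  ∃ D : Orientation G, (∀ v ∈ V₁, outDeg D v = 1) ∧ (∀ v ∈ V₂, outDeg D v = 2)

/-- `d(A)`: the number of edges of `G` with exactly one endvertex in `A`. -/
noncomputable def cutCard (G : SimpleGraph V) (A : Set V) : ℕ :=
  {e ∈ G.edgeSet | ∃ u ∈ A, ∃ v ∉ A, e = s(u, v)}.ncard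

/-- `Δ(A) = | |V₂ ∩ A| - |V₁ ∩ A| |` (as an integer). -/
noncomputable def disc (V₁ V₂ A : Set V) : ℤ :=
  |((V₂ ∩ A).ncard : ℤ) - ((V₁ ∩ A).ncard : ℤ)|

/-- Every connected component of the subgraph induced on `S` is a tree on
at most `k - 2` vertices. -/
def WeakSide (G : SimpleGraph V) (k : ℕ) (S : Set V) : Prop :=
  (G.induce S).IsAcyclic ∧
    ∀ c : (G.induce S).ConnectedComponent, c.supp.ncard ≤ k - 2

/-- A `k`-weak bisection. -/
def KWeak [Fintype V] (G : SimpleGraph V) (k : ℕ) (V₁ V₂ : Set V) : Prop :=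
  IsBisection V₁ V₂ ∧ WeakSide G k V₁ ∧ WeakSide G k V₂

/-- A balanced orientation: every outdegree is 1 or 2. -/
def Balanced {G : SimpleGraph V} (D : Orientation G) : Prop :=
  ∀ v : V, outDeg D v = 1 ∨ outDeg D v = 2

section Multigraph

variable {E A : Type*} [Fintype E]

section Boundary

variable [AddCommGroup A]

/-- The net outflow of `f` at `v` in the directed multigraph in which the edge `e` runs from
`s e` to `t e`. -/
noncomputable def bdry (s t : E → V) (f : E → A) (v : V) : A :=
  ∑ e, ((if s e = v then f e else 0) - (if t e = v then f e else 0))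

/-- The edges with exactly one end in `S`. -/
noncomputable def cut (s t : E → V) (S : Finset V) : Finset E :=
  univ.filter fun e => ¬(s e ∈ S ↔ t e ∈ S)

lemma mem_cut {s t : E → V} {S : Finset V} {e : E} :
    e ∈ cut s t S ↔ ¬(s e ∈ S ↔ t e ∈ S) := by
  simp [cut]

lemma sum_bdry (s t : E → V) (f : E → A) (S : Finset V) :
    ∑ v ∈ S, bdry s t f v =
      ∑ e, ((if s e ∈ S then f e else 0) - (if t e ∈ S then f e else 0)) := by
  unfold bdry
  rw [Finset.sum_comm]
  refine Finset.sum_congr rfl fun e _ => ?_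
  rw [Finset.sum_sub_distrib, Finset.sum_ite_eq, Finset.sum_ite_eq]

lemma bdry_comp [Fintype V] (s t : E → V) (π : V → V) (f : E → A) (w : V) :
    bdry (π ∘ s) (π ∘ t) f w = ∑ v ∈ univ.filter (fun v => π v = w), bdry s t f v := by
  rw [sum_bdry]
  simp [bdry]

lemma bdry_add (s t : E → V) (f g : E → A) (v : V) :
    bdry s t (f + g) v = bdry s t f v + bdry s t g v := by
  unfold bdry
  rw [← Finset.sum_add_distrib]
  refine Finset.sum_congr rfl fun e _ => ?_
  simp only [Pi.add_apply]
  split_ifs <;> abel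

lemma bdry_map {B : Type*} [AddCommGroup B] (φ : A →+ B) (s t : E → V) (f : E → A) (v : V) :
    bdry s t (fun e => φ (f e)) v = φ (bdry s t f v) := by
  unfold bdry
  rw [map_sum]
  refine Finset.sum_congr rfl fun e _ => ?_
  split_ifs <;> simp

lemma bdry_sum {ι : Type*} (I : Finset ι) (s t : E → V) (f : ι → E → A) (v : V) :
    bdry s t (∑ i ∈ I, f i) v = ∑ i ∈ I, bdry s t (f i) v := by
  induction I using Finset.induction_on with
  | empty => simp [bdry]
  | insert i I hi ih => rw [Finset.sum_insert hi, Finset.sum_insert hi, bdry_add, ih]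

lemma bdry_single (s t : E → V) (e : E) (a : A) (v : V) :
    bdry s t (Pi.single e a) v = (if s e = v then a else 0) - (if t e = v then a else 0) := by
  unfold bdry
  rw [Finset.sum_eq_single e]
  · simp
  · intro e' _ he'
    simp [Pi.single_eq_of_ne he']
  · simp

/-- The boundary only depends on the values on edges that are not loops. -/
lemma bdry_congr {s t : E → V} {f g : E → A} (h : ∀ e, s e ≠ t e → f e = g e) (v : V) :
    bdry s t f v = bdry s t g v := by
  refine Finset.sum_congr rfl fun e _ => ?_
  by_cases he : s e = t e
  · simp [he]
  · rw [h e he]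

lemma bdry_restrict {s t : E → V} {K : Finset V} {f : E → A}
    (h : ∀ e, f e ≠ 0 → (s e ∈ K ↔ t e ∈ K)) (v : V) :
    bdry s t (fun e => if s e ∈ K then f e else 0) v = if v ∈ K then bdry s t f v else 0 := by
  unfold bdry
  have hK : ∀ e, (s e ∈ K ↔ t e ∈ K) ∨ f e = 0 := fun e => by
    by_cases hf : f e = 0
    · exact Or.inr hf
    · exact Or.inl (h e hf)
  split_ifs with hv
  · refine Finset.sum_congr rfl fun e _ => ?_
    rcases hK e with he | he
    · congr 1 <;> split_ifs <;> simp_all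
    · simp [he]
  · refine Finset.sum_eq_zero fun e _ => ?_
    rcases hK e with he | he
    · rw [sub_eq_zero]
      split_ifs <;> simp_all
    · simp [he]

end Boundary

/-- From `x`, the vertices to which one more unit can be sent within the bounds form a set whose
outgoing edges are saturated. -/
lemma exists_residual_set [Fintype V] (s t : E → V) (lo hi g : E → ℤ) (hlo : lo ≤ g)
    (hhi : g ≤ hi) (x : V) :
    ∃ S : Finset V, x ∈ S ∧
      (∀ z ∈ S, ∃ p : E → ℤ, lo ≤ g + p ∧ g + p ≤ hi ∧
        ∀ v, bdry s t p v = (if x = v then 1 else 0) - (if z = v then 1 else 0)) ∧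
      ∀ e, (s e ∈ S → t e ∉ S → g e = hi e) ∧ (t e ∈ S → s e ∉ S → g e = lo e) := by
  let P : Finset V → Prop := fun S => x ∈ S ∧ ∀ z ∈ S, ∃ p : E → ℤ, lo ≤ g + p ∧ g + p ≤ hi ∧
    (∀ e, p e ≠ 0 → s e ∈ S ∧ t e ∈ S) ∧
    ∀ v, bdry s t p v = (if x = v then 1 else 0) - (if z = v then 1 else 0)
  have hP : P {x} := by
    refine ⟨by simp, fun z hz => ⟨0, by simpa, by simpa, by simp, fun v => ?_⟩⟩
    rw [Finset.mem_singleton] at hz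
    subst hz
    simp [bdry]
  obtain ⟨S, -, hS⟩ := Finite.exists_le_maximal hP
  -- an unsaturated edge would allow enlarging `S`
  have extend : ∀ (e : E) (z w : V) (a : ℤ), z ∈ S → w ∉ S →
      (s e ∈ S → t e ∉ S) → (s e = z ∨ s e = w) → (t e = z ∨ t e = w) →
      lo e ≤ g e + a → g e + a ≤ hi e →
      (∀ v, bdry s t (Pi.single e a) v =
        (if z = v then 1 else 0) - (if w = v then 1 else 0)) → False := by
    intro e z w a hz hw hst hs ht h1 h2 h3
    have hins : P (insert w S) := by
      refine ⟨Finset.mem_insert_of_mem hS.1.1, fun y hy => ?_⟩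
      rcases Finset.mem_insert.1 hy with rfl | hy
      · obtain ⟨p, hp1, hp2, hp3, hp4⟩ := hS.1.2 z hz
        have hpe : p e = 0 := by
          by_contra h
          exact hst (hp3 e h).1 (hp3 e h).2
        refine ⟨p + Pi.single e a, fun e' => ?_, fun e' => ?_, fun e' he' => ?_, fun v => ?_⟩
        · by_cases h : e' = e
          · subst h; simpa [hpe] using h1
          · simpa [Pi.single_eq_of_ne h] using hp1 e'
        · by_cases h : e' = e
          · subst h; simpa [hpe] using h2
          · simpa [Pi.single_eq_of_ne h] using hp2 e'
        · by_cases h : e' = e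
          · subst h
            constructor
            · rcases hs with hs | hs <;> simp [hs, hz]
            · rcases ht with ht | ht <;> simp [ht, hz]
          · have := hp3 e' (by simpa [Pi.single_eq_of_ne h] using he')
            simp [this]
        · rw [bdry_add, hp4, h3]; ring
      · obtain ⟨p, hp1, hp2, hp3, hp4⟩ := hS.1.2 y hy
        exact ⟨p, hp1, hp2, fun e' he' => by simp [hp3 e' he'], hp4⟩
    exact hw (hS.2 hins (Finset.subset_insert _ _) (Finset.mem_insert_self _ _))
  refine ⟨S, hS.1.1, fun z hz => ?_, fun e => ⟨fun h1 h2 => ?_, fun h1 h2 => ?_⟩⟩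
  · obtain ⟨p, hp1, hp2, -, hp4⟩ := hS.1.2 z hz
    exact ⟨p, hp1, hp2, hp4⟩
  · by_contra hne
    have h3 : lo e ≤ g e := hlo e
    have h4 : g e ≤ hi e := hhi e
    refine extend e (s e) (t e) 1 h1 h2 (fun _ => h2) (by simp) (by simp) (by omega) (by omega)
      fun v => bdry_single s t e 1 v
  · by_contra hne
    have h3 : lo e ≤ g e := hlo e
    have h4 : g e ≤ hi e := hhi e
    refine extend e (t e) (s e) (-1) h1 h2 (fun h => absurd h h2) (by simp) (by simp) (by omega)
      (by omega) fun v => ?_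
    rw [bdry_single]
    split_ifs <;> simp

/-- **Integral feasible flow theorem**: a demand `b` is met by an integral flow within the bounds
`lo` and `hi` as soon as every vertex set can send out its total demand. -/
theorem exists_bdry_eq [Fintype V] (s t : E → V) (lo hi : E → ℤ) (hlh : lo ≤ hi) (b : V → ℤ)
    (hb : ∑ v, b v = 0)
    (hcut : ∀ S : Finset V, ∑ v ∈ S, b v ≤
      ∑ e, ((if s e ∈ S ∧ t e ∉ S then hi e else 0) - (if t e ∈ S ∧ s e ∉ S then lo e else 0))) :
    ∃ g : E → ℤ, lo ≤ g ∧ g ≤ hi ∧ ∀ v, bdry s t g v = b v := by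
  let N : (E → ℤ) → ℕ := fun g => ∑ v, (bdry s t g v - b v).natAbs
  have hex : ∃ n g, lo ≤ g ∧ g ≤ hi ∧ N g = n := ⟨_, lo, le_refl _, hlh, rfl⟩
  obtain ⟨g, hlo, hhi, hN⟩ := Nat.find_spec hex
  have hmin : ∀ g', lo ≤ g' → g' ≤ hi → N g ≤ N g' := fun g' h1 h2 =>
    hN ▸ Nat.find_min' hex ⟨g', h1, h2, rfl⟩
  refine ⟨g, hlo, hhi, ?_⟩
  by_contra hne
  push Not at hne
  have htot : ∑ v, bdry s t g v = 0 := by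
    rw [sum_bdry]; simp
  have hx : ∃ x, bdry s t g x < b x := by
    by_contra hcon
    push Not at hcon
    obtain ⟨v, hv⟩ := hne
    have := Finset.sum_lt_sum (fun i (_ : i ∈ univ) => hcon i)
      ⟨v, Finset.mem_univ v, lt_of_le_of_ne (hcon v) (Ne.symm hv)⟩
    omega
  obtain ⟨x, hx⟩ := hx
  obtain ⟨S, hxS, hp, hsat⟩ := exists_residual_set s t lo hi g hlo hhi x
  have hz : ∃ z ∈ S, b z < bdry s t g z := by
    by_contra hcon
    push Not at hcon
    have h1 := Finset.sum_lt_sum hcon ⟨x, hxS, hx⟩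
    rw [sum_bdry] at h1
    have h2 := hcut S
    refine absurd (lt_of_lt_of_le h1 h2) (not_lt.2 (Finset.sum_le_sum fun e _ => ?_))
    have h3 := (hsat e).1
    have h4 := (hsat e).2
    by_cases hs : s e ∈ S <;> by_cases ht : t e ∈ S <;> simp_all
  obtain ⟨z, hzS, hz⟩ := hz
  obtain ⟨p, hp1, hp2, hp3⟩ := hp z hzS
  have hle := hmin _ hp1 hp2
  refine absurd hle (not_le.2 (Finset.sum_lt_sum (fun v _ => ?_) ⟨x, Finset.mem_univ x, ?_⟩))
  · rw [bdry_add, hp3]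
    split_ifs with h1 h2 h2
    · omega
    · subst h1; omega
    · subst h2; omega
    · omega
  · have hzx : z ≠ x := by rintro rfl; omega
    rw [bdry_add, hp3]
    simp only [if_true, hzx, if_false]
    omega

/-- The edges joining `P` to `Q`. -/
noncomputable def between (s t : E → V) (P Q : Finset V) : Finset E :=
  univ.filter fun e => (s e ∈ P ∧ t e ∈ Q) ∨ (s e ∈ Q ∧ t e ∈ P)

lemma mem_between {s t : E → V} {P Q : Finset V} {e : E} :
    e ∈ between s t P Q ↔ (s e ∈ P ∧ t e ∈ Q) ∨ (s e ∈ Q ∧ t e ∈ P) := by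
  simp [between]

lemma card_between_add_le (s t : E → V) {S B R : Finset V} (hSB : S ⊆ B) (hBR : Disjoint B R) :
    #(between s t S R) + #(between s t (B \ S) R) ≤ #(between s t B R) := by
  have hS : ∀ x, x ∈ S → x ∈ B := fun x hx => hSB hx
  have hR : ∀ x, x ∈ B → x ∉ R := fun x hx => Finset.disjoint_left.1 hBR hx
  rw [← Finset.card_union_of_disjoint]
  · refine Finset.card_le_card fun e => ?_
    simp only [Finset.mem_union, mem_between, Finset.mem_sdiff]
    grind
  · rw [Finset.disjoint_left]
    intro e
    simp only [mem_between, Finset.mem_sdiff]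
    grind

lemma between_comm (s t : E → V) (P Q : Finset V) : between s t P Q = between s t Q P := by
  ext e
  rw [mem_between, mem_between, or_comm]

lemma between_subset_cut (s t : E → V) {P Q : Finset V} (hPQ : Disjoint P Q) :
    between s t P Q ⊆ cut s t P := by
  intro e
  have h : ∀ x, x ∈ P → x ∉ Q := fun x hx => Finset.disjoint_left.1 hPQ hx
  simp only [mem_between, mem_cut]
  grind

lemma cut_subset_union (s t : E → V) {S B : Finset V} (hSB : S ⊆ B) :
    cut s t B ⊆ cut s t S ∪ cut s t (B \ S) := by
  intro e
  have hS : ∀ x, x ∈ S → x ∈ B := fun x hx => hSB hx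
  simp only [Finset.mem_union, mem_cut, Finset.mem_sdiff]
  grind

/-- A graph without cuts of size one or two has, away from `u`, a 2-edge-connected set of vertices
that sends at least two edges to `u`. -/
lemma exists_leaf_block [Fintype V] (s t : E → V) (u : V)
    (h3 : ∀ S : Finset V, cut s t S = ∅ ∨ 3 ≤ #(cut s t S))
    (hu : (cut s t {u}).Nonempty) :
    ∃ B : Finset V, u ∉ B ∧ 2 ≤ #(between s t B {u}) ∧
      ∀ S ⊆ B, S.Nonempty → S ≠ B → 2 ≤ #(between s t S (B \ S)) := by
  let P : Finset V → Prop := fun B =>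
    u ∉ B ∧ (cut s t B).Nonempty ∧ #(between s t B (univ \ insert u B)) ≤ 1
  have hP : P (univ \ {u}) := by
    refine ⟨by simp, ?_, ?_⟩
    · obtain ⟨e, he⟩ := hu
      refine ⟨e, ?_⟩
      rw [mem_cut] at he ⊢
      simpa [not_iff_not] using he
    · simp [between]
  obtain ⟨B, -, hB⟩ := Finite.exists_le_minimal hP
  obtain ⟨⟨huB, hcB, hrB⟩, hmin⟩ := hB
  refine ⟨B, huB, ?_, fun S hSB hSne hSB' => ?_⟩
  · have h1 : cut s t B ⊆ between s t B {u} ∪ between s t B (univ \ insert u B) := by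
      intro e
      simp only [mem_cut, Finset.mem_union, mem_between, Finset.mem_sdiff, Finset.mem_insert,
        Finset.mem_singleton, Finset.mem_univ]
      tauto
    have h2 := (Finset.card_le_card h1).trans (Finset.card_union_le _ _)
    rcases h3 B with h | h
    · simp [h] at hcB
    · omega
  · by_contra hlt
    push Not at hlt
    set T := B \ S with hT
    set R := univ \ insert u B with hR
    have key : ∀ X : Finset V, X ⊆ B → X ≠ B → cut s t X = ∅ ∨
        2 ≤ #(between s t X R) + #(between s t X (B \ X)) := by
      intro X hX hXB
      by_contra hcon
      push Not at hcon
      have hPX : P X := by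
        refine ⟨fun h => huB (hX h), hcon.1, ?_⟩
        have hsub : between s t X (univ \ insert u X) ⊆
            between s t X R ∪ between s t X (B \ X) := by
          intro e
          simp only [hR, Finset.mem_union, mem_between, Finset.mem_sdiff, Finset.mem_insert,
            Finset.mem_univ]
          tauto
        have := (Finset.card_le_card hsub).trans (Finset.card_union_le _ _)
        omega
      exact hXB (Finset.Subset.antisymm hX (hmin hPX hX))
    have hTB : T ⊆ B := Finset.sdiff_subset
    have hTB' : T ≠ B := by
      intro h
      obtain ⟨x, hx⟩ := hSne
      have : x ∈ T := h ▸ hSB hx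
      exact (Finset.mem_sdiff.1 this).2 hx
    have hBT : B \ T = S := by rw [hT, Finset.sdiff_sdiff_eq_self hSB]
    have hsymm : between s t T S = between s t S T := between_comm s t T S
    have hsum : #(between s t S R) + #(between s t T R) ≤ #(between s t B R) :=
      card_between_add_le s t hSB (by
        rw [hR, Finset.disjoint_left]
        exact fun x hx hx' => (Finset.mem_sdiff.1 hx').2 (Finset.mem_insert_of_mem hx))
    have hsubS : between s t S T ⊆ cut s t S :=
      between_subset_cut s t Finset.disjoint_sdiff
    have hsubT : between s t S T ⊆ cut s t T :=
      hsymm ▸ between_subset_cut s t Finset.sdiff_disjoint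
    have hk1 := key S hSB hSB'
    have hk2 := key T hTB hTB'
    rw [hBT, hsymm] at hk2
    rw [← hT] at hk1
    rcases hk1 with h1 | h1 <;> rcases hk2 with h2 | h2
    · have := cut_subset_union s t hSB
      rw [← hT, h1, h2, Finset.union_empty, Finset.subset_empty] at this
      exact hcB.ne_empty this
    · rw [h1, Finset.subset_empty] at hsubS
      rw [hsubS] at h2
      simp at h2
      omega
    · rw [h2, Finset.subset_empty] at hsubT
      rw [hsubT] at h1
      simp at h1
      omega
    · omega

/-- Two units can be sent between any two vertices of a 2-edge-connected set `B` inside `B`,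
using each edge at most once. -/
lemma exists_two_unit_flow [Fintype V] (s t : E → V) (B : Finset V)
    (hB : ∀ S ⊆ B, S.Nonempty → S ≠ B → 2 ≤ #(between s t S (B \ S)))
    {x y : V} (hx : x ∈ B) (hy : y ∈ B) :
    ∃ f : E → ℤ, (∀ e, |f e| ≤ 1) ∧ (∀ e, f e ≠ 0 → s e ∈ B ∧ t e ∈ B) ∧
      ∀ v, bdry s t f v = 2 * ((if x = v then 1 else 0) - (if y = v then 1 else 0)) := by
  let c : E → ℤ := fun e => if s e ∈ B ∧ t e ∈ B then 1 else 0
  have hc : ∀ e, 0 ≤ c e := fun e => by simp only [c]; split_ifs <;> simp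
  obtain ⟨f, h1, h2, h3⟩ := exists_bdry_eq s t (-c) c
    (fun e => by have := hc e; simp only [Pi.neg_apply]; omega)
    (fun v => 2 * ((if x = v then 1 else 0) - (if y = v then 1 else 0)))
    (by rw [← Finset.mul_sum, Finset.sum_sub_distrib]; simp)
    (by
      intro S
      have hrhs : ∑ e, ((if s e ∈ S ∧ t e ∉ S then c e else 0) -
          (if t e ∈ S ∧ s e ∉ S then (-c) e else 0)) =
          (#(between s t (S ∩ B) (B \ (S ∩ B))) : ℤ) := by
        rw [between, Finset.card_filter, Nat.cast_sum]
        refine Finset.sum_congr rfl fun e _ => ?_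
        simp only [c, Pi.neg_apply, Finset.mem_inter, Finset.mem_sdiff]
        by_cases a1 : s e ∈ S <;> by_cases a2 : t e ∈ S <;> by_cases a3 : s e ∈ B <;>
          by_cases a4 : t e ∈ B <;> simp [a1, a2, a3, a4]
      rw [hrhs, ← Finset.mul_sum, Finset.sum_sub_distrib, Finset.sum_ite_eq, Finset.sum_ite_eq]
      by_cases hxS : x ∈ S <;> by_cases hyS : y ∈ S
      · simp [hxS, hyS]
      · have := hB (S ∩ B) Finset.inter_subset_right ⟨x, by simp [hxS, hx]⟩
          (fun h => hyS (Finset.mem_inter.1 ((Finset.ext_iff.1 h y).2 hy)).1)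
        simp only [hxS, hyS, if_true, if_false]
        omega
      · simp only [hxS, hyS, if_true, if_false]
        omega
      · simp [hxS, hyS])
  refine ⟨f, fun e => ?_, fun e he => ?_, h3⟩
  · have h1 : -c e ≤ f e := h1 e
    have h2 : f e ≤ c e := h2 e
    have hc1 : c e ≤ 1 := by simp only [c]; split_ifs <;> simp
    rw [abs_le]
    constructor <;> omega
  · by_contra hcon
    have h1 : -c e ≤ f e := h1 e
    have h2 : f e ≤ c e := h2 e
    simp only [c, hcon, if_false] at h1 h2
    omega

/-- The bundle of data contracted in one step of the induction: a closed set `K` around `u`, an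
integral circulation `h` whose support spans `K` modulo three, and an even circulation `f` covering
all but two edges of that support and avoiding `u`. -/
lemma exists_contractible_set [Fintype V] (s t : E → V) (u : V)
    (h3 : ∀ S : Finset V, cut s t S = ∅ ∨ 3 ≤ #(cut s t S))
    (hu : (cut s t {u}).Nonempty) :
    ∃ (K : Finset V) (f : E → ZMod 2) (h : E → ZMod 3) (e₁ e₂ : E),
      u ∈ K ∧ s e₁ ≠ t e₁ ∧ s e₁ ∈ K ∧ t e₁ ∈ K ∧
      (∀ v, bdry s t f v = 0) ∧ (∀ v, bdry s t h v = 0) ∧ h e₁ ≠ 0 ∧ h e₂ ≠ 0 ∧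
      (∀ e, h e ≠ 0 → (s e ∈ K ∧ t e ∈ K) ∧ (e = e₁ ∨ e = e₂ ∨ f e ≠ 0)) ∧
      (∀ e, f e ≠ 0 → (s e ∈ K ∧ t e ∈ K) ∧ s e ≠ u ∧ t e ≠ u) ∧
      ∀ z ∈ K, ∃ p : E → ZMod 3, (∀ e, p e ≠ 0 → h e ≠ 0) ∧
        ∀ v, bdry s t p v = (if u = v then 1 else 0) - (if z = v then 1 else 0) := by
  obtain ⟨B, huB, hBu, hB⟩ := exists_leaf_block s t u h3 hu
  obtain ⟨e₁, he₁, e₂, he₂, hne⟩ := Finset.one_lt_card.1 hBu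
  have hend : ∀ e ∈ between s t B {u}, ∃ x ∈ B, ∃ a : ℤ, (a = 1 ∨ a = -1) ∧
      ∀ v, bdry s t (Pi.single e a) v = (if u = v then 1 else 0) - (if x = v then 1 else 0) := by
    intro e he
    rw [mem_between, Finset.mem_singleton, Finset.mem_singleton] at he
    rcases he with ⟨h1, h2⟩ | ⟨h1, h2⟩
    · refine ⟨s e, h1, -1, by simp, fun v => ?_⟩
      rw [bdry_single, h2]
      split_ifs <;> simp
    · refine ⟨t e, h2, 1, by simp, fun v => ?_⟩
      rw [bdry_single, h1]
  obtain ⟨x₁, hx₁, a₁, ha₁, hb₁⟩ := hend e₁ he₁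
  obtain ⟨x₂, hx₂, a₂, ha₂, hb₂⟩ := hend e₂ he₂
  obtain ⟨f, hf1, hfB, hf⟩ := exists_two_unit_flow s t B hB hx₁ hx₂
  have hnotB : ∀ e ∈ between s t B {u}, f e = 0 := by
    intro e he
    by_contra h
    have := hfB e h
    rw [mem_between, Finset.mem_singleton, Finset.mem_singleton] at he
    rcases he with ⟨h1, h2⟩ | ⟨h1, h2⟩
    · exact huB (h2 ▸ this.2)
    · exact huB (h1 ▸ this.1)
  let hI : E → ℤ := f + (Pi.single e₁ a₁ + Pi.single e₁ a₁) +
    (Pi.single e₂ (-a₂) + Pi.single e₂ (-a₂))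
  have hI0 : ∀ v, bdry s t hI v = 0 := by
    intro v
    have hneg : bdry s t (Pi.single e₂ (-a₂)) v = -bdry s t (Pi.single e₂ a₂) v := by
      rw [bdry_single, bdry_single]; split_ifs <;> simp
    simp only [hI, bdry_add, hneg, hb₁, hb₂, hf]
    ring
  have hI1 : hI e₁ = 2 * a₁ := by
    simp [hI, hnotB e₁ he₁, Pi.single_eq_of_ne hne]; ring
  have hI2 : hI e₂ = -2 * a₂ := by
    simp [hI, hnotB e₂ he₂, Pi.single_eq_of_ne hne.symm]; ring
  have hIe : ∀ e, e ≠ e₁ → e ≠ e₂ → hI e = f e := by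
    intro e h1 h2
    simp [hI, Pi.single_eq_of_ne h1, Pi.single_eq_of_ne h2]
  let h : E → ZMod 3 := fun e => (hI e : ZMod 3)
  have hh0 : ∀ v, bdry s t h v = 0 := by
    intro v
    have := bdry_map (Int.castAddHom (ZMod 3)) s t hI v
    rw [hI0, map_zero] at this
    exact this
  have hh1 : h e₁ ≠ 0 := by
    simp only [h, hI1]
    rcases ha₁ with rfl | rfl <;> decide
  have hh2 : h e₂ ≠ 0 := by
    simp only [h, hI2]
    rcases ha₂ with rfl | rfl <;> decide
  let f₂ : E → ZMod 2 := fun e => (f e : ZMod 2)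
  have hf₂0 : ∀ v, bdry s t f₂ v = 0 := by
    intro v
    have := bdry_map (Int.castAddHom (ZMod 2)) s t f v
    rw [hf, two_mul, map_add, CharTwo.add_self_eq_zero] at this
    exact this
  have hf₂h : ∀ e, f₂ e ≠ 0 ↔ f e ≠ 0 := by
    intro e
    have := abs_le.1 (hf1 e)
    have h3 : f e = -1 ∨ f e = 0 ∨ f e = 1 := by omega
    simp only [f₂]
    rcases h3 with h3 | h3 | h3 <;> rw [h3] <;> decide
  have hcov : ∀ e, h e ≠ 0 → e = e₁ ∨ e = e₂ ∨ f₂ e ≠ 0 := by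
    intro e he
    by_cases h1 : e = e₁
    · exact Or.inl h1
    by_cases h2 : e = e₂
    · exact Or.inr (Or.inl h2)
    refine Or.inr (Or.inr ((hf₂h e).2 fun h0 => he ?_))
    simp [h, hIe e h1 h2, h0]
  have hfh : ∀ e, f₂ e ≠ 0 → h e ≠ 0 := by
    intro e he
    have he' := (hf₂h e).1 he
    have h1 : e ≠ e₁ := fun h => he' (h ▸ hnotB e₁ he₁)
    have h2 : e ≠ e₂ := fun h => he' (h ▸ hnotB e₂ he₂)
    simp only [h, hIe e h1 h2]
    have := abs_le.1 (hf1 e)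
    have h3 : f e = -1 ∨ f e = 1 := by omega
    rcases h3 with h3 | h3 <;> rw [h3] <;> decide
  let Q : V → Prop := fun z => ∃ p : E → ZMod 3, (∀ e, p e ≠ 0 → h e ≠ 0) ∧
    ∀ v, bdry s t p v = (if u = v then 1 else 0) - (if z = v then 1 else 0)
  have hQu : Q u := ⟨0, by simp, fun v => by simp [bdry]⟩
  have hQstep : ∀ e, h e ≠ 0 → (Q (s e) ↔ Q (t e)) := by
    intro e he
    constructor
    · rintro ⟨p, hp, hpb⟩
      refine ⟨p + Pi.single e 1, fun e' he' => ?_, fun v => ?_⟩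
      · by_cases h1 : e' = e
        · rwa [h1]
        · exact hp e' (by simpa [Pi.single_eq_of_ne h1] using he')
      · rw [bdry_add, hpb, bdry_single]; ring
    · rintro ⟨p, hp, hpb⟩
      refine ⟨p + Pi.single e (-1), fun e' he' => ?_, fun v => ?_⟩
      · by_cases h1 : e' = e
        · rwa [h1]
        · exact hp e' (by simpa [Pi.single_eq_of_ne h1] using he')
      · rw [bdry_add, hpb, bdry_single]
        split_ifs <;> ring
  let K : Finset V := univ.filter Q
  have hK : ∀ z, z ∈ K ↔ Q z := fun z => by simp [K]
  have hKstep : ∀ e, h e ≠ 0 → (s e ∈ K ↔ t e ∈ K) := fun e he => by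
    rw [hK, hK]; exact hQstep e he
  have huK : u ∈ K := (hK u).2 hQu
  have hinK : ∀ e ∈ between s t B {u}, h e ≠ 0 → s e ∈ K ∧ t e ∈ K := by
    intro e he h0
    have h1 := hKstep e h0
    rw [mem_between, Finset.mem_singleton, Finset.mem_singleton] at he
    rcases he with ⟨-, h2⟩ | ⟨h2, -⟩
    · rw [h2] at h1 ⊢; exact ⟨h1.2 huK, huK⟩
    · rw [h2] at h1 ⊢; exact ⟨huK, h1.1 huK⟩
  have hK1 := hinK e₁ he₁ hh1
  have hK2 := hinK e₂ he₂ hh2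
  refine ⟨K, fun e => if s e ∈ K then f₂ e else 0, fun e => if s e ∈ K then h e else 0, e₁, e₂,
    huK, ?_, hK1.1, hK1.2, fun v => ?_, fun v => ?_, ?_, ?_, fun e he => ?_, fun e he => ?_,
    fun z hz => ?_⟩
  · intro heq
    rw [mem_between, Finset.mem_singleton, Finset.mem_singleton] at he₁
    rcases he₁ with ⟨h1, h2⟩ | ⟨h1, h2⟩
    · exact huB (h2 ▸ heq ▸ h1)
    · exact huB (h1 ▸ heq ▸ h2)
  · rw [bdry_restrict fun e he => hKstep e (hfh e he), hf₂0, ite_self]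
  · rw [bdry_restrict hKstep, hh0, ite_self]
  · simpa [hK1.1] using hh1
  · simpa [hK2.1] using hh2
  · have hs : s e ∈ K := by by_contra h; simp [h] at he
    have he' : h e ≠ 0 := by simpa [hs] using he
    refine ⟨⟨hs, (hKstep e he').1 hs⟩, ?_⟩
    simpa [hs] using hcov e he'
  · have hs : s e ∈ K := by by_contra h; simp [h] at he
    have he' : f₂ e ≠ 0 := by simpa [hs] using he
    have heB := hfB e ((hf₂h e).1 he')
    exact ⟨⟨hs, (hKstep e (hfh e he')).1 hs⟩, fun h => huB (h ▸ heB.1), fun h => huB (h ▸ heB.2)⟩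
  · obtain ⟨p, hp, hpb⟩ := (hK z).1 hz
    refine ⟨fun e => if s e ∈ K then p e else 0, fun e he => ?_, fun v => ?_⟩
    · have hs : s e ∈ K := by by_contra h; simp [h] at he
      simp only [hs, if_true] at he ⊢
      exact hp e he
    · rw [bdry_restrict fun e he => hKstep e (hp e he), hpb]
      split_ifs with h1 h2 h3 h2 h3 <;> simp_all

/-- The edges that are not loops. -/
noncomputable def nonloops (s t : E → V) : Finset E :=
  univ.filter fun e => s e ≠ t e

lemma nonloops_comp_ssubset {s t : E → V} {π : V → V} {e : E} (he : s e ≠ t e)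
    (hπ : π (s e) = π (t e)) : nonloops (π ∘ s) (π ∘ t) ⊂ nonloops s t := by
  rw [Finset.ssubset_iff_of_subset]
  · exact ⟨e, by simp [nonloops, he], by simp [nonloops, hπ]⟩
  · intro e'
    simp only [nonloops, Finset.mem_filter, Finset.mem_univ, true_and, Function.comp_apply]
    exact fun h h' => h (by rw [h'])

lemma cut_comp [Fintype V] (s t : E → V) (π : V → V) (S : Finset V) :
    cut (π ∘ s) (π ∘ t) S = cut s t (univ.filter fun v => π v ∈ S) := by
  ext e; simp [mem_cut]

/-- A graph without cuts of size one or two carries a flow over `ZMod 2` and a flow over `ZMod 3`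
that have no common zero, the former vanishing around a prescribed vertex with a proper edge. -/
lemma exists_flow_pair_of_contraction [Fintype V] (s t : E → V) (u : V)
    (h3 : ∀ S : Finset V, cut s t S = ∅ ∨ 3 ≤ #(cut s t S))
    (hu : (cut s t {u}).Nonempty)
    (ih : ∀ s' t' : E → V, #(nonloops s' t') < #(nonloops s t) →
      (∀ S : Finset V, cut s' t' S = ∅ ∨ 3 ≤ #(cut s' t' S)) →
      ∃ (a : E → ZMod 2) (b : E → ZMod 3), (∀ v, bdry s' t' a v = 0) ∧
        (∀ v, bdry s' t' b v = 0) ∧ (∀ e, s' e = u ∨ t' e = u → a e = 0) ∧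
        ∀ e, a e ≠ 0 ∨ b e ≠ 0) :
    ∃ (a : E → ZMod 2) (b : E → ZMod 3), (∀ v, bdry s t a v = 0) ∧
      (∀ v, bdry s t b v = 0) ∧ (∀ e, s e = u ∨ t e = u → a e = 0) ∧
      ∀ e, a e ≠ 0 ∨ b e ≠ 0 := by
  obtain ⟨K, f, h, e₁, e₂, huK, hne, hs₁, ht₁, hf0, hh0, hh₁, hh₂, hhK, hfK, hspan⟩ :=
    exists_contractible_set s t u h3 hu
  let π : V → V := fun v => if v ∈ K then u else v
  have hπ : ∀ v, v ∈ K → π v = u := fun v hv => by simp [π, hv]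
  have hπ' : ∀ v, v ∉ K → π v = v := fun v hv => by simp [π, hv]
  obtain ⟨a, b, ha, hb, hau, hab⟩ := ih (π ∘ s) (π ∘ t)
    (Finset.card_lt_card (nonloops_comp_ssubset hne (by rw [hπ _ hs₁, hπ _ ht₁])))
    (fun S => by rw [cut_comp]; exact h3 _)
  have haK : ∀ e, s e ∈ K ∨ t e ∈ K → a e = 0 := by
    rintro e (he | he)
    · exact hau e (Or.inl (hπ _ he))
    · exact hau e (Or.inr (hπ _ he))
  have fibre : ∀ w, w ∉ K → univ.filter (fun v => π v = w) = {w} := by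
    intro w hw
    ext v
    simp only [Finset.mem_filter, Finset.mem_univ, true_and, Finset.mem_singleton]
    by_cases hv : v ∈ K
    · rw [hπ v hv]
      exact ⟨fun h => absurd (h ▸ huK) hw, fun h => absurd (h ▸ hv) hw⟩
    · rw [hπ' v hv]
  have fibre_u : univ.filter (fun v => π v = u) = K := by
    ext v
    simp only [Finset.mem_filter, Finset.mem_univ, true_and]
    by_cases hv : v ∈ K
    · simp [hπ v hv, hv]
    · rw [hπ' v hv]
      exact ⟨fun h => h ▸ huK, fun h => absurd h hv⟩
  have ha0 : ∀ v, bdry s t a v = 0 := by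
    intro v
    by_cases hv : v ∈ K
    · refine Finset.sum_eq_zero fun e _ => ?_
      have h1 : s e = v → a e = 0 := fun h => haK e (Or.inl (h ▸ hv))
      have h2 : t e = v → a e = 0 := fun h => haK e (Or.inr (h ▸ hv))
      split_ifs <;> simp_all
    · have := ha v
      rwa [bdry_comp, fibre v hv, Finset.sum_singleton] at this
  have hb0 : ∀ v, v ∉ K → bdry s t b v = 0 := by
    intro v hv
    have := hb v
    rwa [bdry_comp, fibre v hv, Finset.sum_singleton] at this
  have hbK : ∑ v ∈ K, bdry s t b v = 0 := by
    have := hb u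
    rwa [bdry_comp, fibre_u] at this
  choose! p hp hpb using hspan
  let q : E → ZMod 3 := ∑ z ∈ K, fun e => bdry s t b z * p z e
  have hq : ∀ e, q e ≠ 0 → h e ≠ 0 := by
    intro e he h0
    refine he ?_
    simp only [q, Finset.sum_apply]
    refine Finset.sum_eq_zero fun z hz => ?_
    have : p z e = 0 := by
      by_contra hpz
      exact hp z hz e hpz h0
    rw [this, mul_zero]
  have hqb : ∀ v, bdry s t q v = -bdry s t b v := by
    intro v
    have h1 : ∀ z ∈ K, bdry s t (fun e => bdry s t b z * p z e) v =
        (if u = v then bdry s t b z else 0) - (if z = v then bdry s t b z else 0) := by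
      intro z hz
      have := bdry_map (AddMonoidHom.mulLeft (bdry s t b z)) s t (p z) v
      simp only [AddMonoidHom.coe_mulLeft] at this
      rw [this, hpb z hz]
      split_ifs <;> ring
    rw [bdry_sum, Finset.sum_congr rfl h1, Finset.sum_sub_distrib, Finset.sum_ite_eq']
    have h2 : ∑ z ∈ K, (if u = v then bdry s t b z else 0) = 0 := by
      split_ifs
      · exact hbK
      · simp
    rw [h2, zero_sub]
    split_ifs with hv
    · rfl
    · rw [hb0 v hv]
  have hc : ∀ x y k l : ZMod 3, k ≠ 0 → l ≠ 0 → ∃ c, x + c * k ≠ 0 ∧ y + c * l ≠ 0 := by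
    decide
  obtain ⟨c, hc₁, hc₂⟩ := hc ((b + q) e₁) ((b + q) e₂) (h e₁) (h e₂) hh₁ hh₂
  refine ⟨a + f, b + q + fun e => c * h e, fun v => ?_, fun v => ?_, fun e he => ?_, fun e => ?_⟩
  · rw [bdry_add, ha0, hf0, add_zero]
  · have := bdry_map (AddMonoidHom.mulLeft c) s t h v
    simp only [AddMonoidHom.coe_mulLeft] at this
    rw [bdry_add, bdry_add, hqb, this, hh0]
    simp
  · have h1 : a e = 0 := by
      rcases he with he | he
      · exact haK e (Or.inl (he ▸ huK))
      · exact haK e (Or.inr (he ▸ huK))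
    have h2 : f e = 0 := by
      by_contra hfe
      have := (hfK e hfe).2
      tauto
    simp [h1, h2]
  · by_cases he : h e = 0
    · have hqe : q e = 0 := by
        by_contra hqe
        exact hq e hqe he
      rcases hab e with h1 | h1
      · left
        have h2 : f e = 0 := by
          by_contra hfe
          exact h1 (haK e (Or.inl (hfK e hfe).1.1))
        simpa [h2] using h1
      · right
        simpa [hqe, he] using h1
    · obtain ⟨⟨hs, -⟩, h1 | h1 | h1⟩ := hhK e he
      · right; rw [h1]; exact hc₁
      · right; rw [h1]; exact hc₂
      · left
        simpa [haK e (Or.inl hs)] using h1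

/-- A graph without cuts of size one or two carries a flow over `ZMod 2` and a flow over `ZMod 3`
that have no common zero, the former vanishing around a prescribed vertex. -/
theorem exists_flow_pair [Fintype V] (n : ℕ) : ∀ (s t : E → V), #(nonloops s t) = n →
    (∀ S : Finset V, cut s t S = ∅ ∨ 3 ≤ #(cut s t S)) → ∀ u : V,
    ∃ (a : E → ZMod 2) (b : E → ZMod 3), (∀ v, bdry s t a v = 0) ∧
      (∀ v, bdry s t b v = 0) ∧ (∀ e, s e = u ∨ t e = u → a e = 0) ∧
      ∀ e, a e ≠ 0 ∨ b e ≠ 0 := by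
  induction n using Nat.strong_induction_on with
  | _ n ih =>
    intro s t hn h3 u
    have step : ∀ w, (cut s t {w}).Nonempty → _ := fun w hw =>
      exists_flow_pair_of_contraction s t w h3 hw fun s' t' hlt h3' =>
        ih _ (hn ▸ hlt) s' t' rfl h3' w
    by_cases hu : (cut s t {u}).Nonempty
    · exact step u hu
    have hloop : ∀ e, s e = u ∨ t e = u → s e = t e := by
      intro e he
      by_contra hne
      refine hu ⟨e, ?_⟩
      rw [mem_cut, Finset.mem_singleton, Finset.mem_singleton]
      rcases he with he | he
      · exact fun h => hne (he.trans (h.1 he).symm)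
      · exact fun h => hne ((h.2 he).trans he.symm)
    have hpair : ∃ (a : E → ZMod 2) (b : E → ZMod 3), (∀ v, bdry s t a v = 0) ∧
        (∀ v, bdry s t b v = 0) ∧ ∀ e, s e ≠ t e → a e ≠ 0 ∨ b e ≠ 0 := by
      by_cases hall : ∀ e, s e = t e
      · exact ⟨0, 0, fun v => by simp [bdry], fun v => by simp [bdry],
          fun e he => absurd (hall e) he⟩
      · push Not at hall
        obtain ⟨e, he⟩ := hall
        obtain ⟨a, b, ha, hb, -, hab⟩ := step (s e) ⟨e, by
          rw [mem_cut, Finset.mem_singleton, Finset.mem_singleton]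
          exact fun h => he (h.1 rfl).symm⟩
        exact ⟨a, b, ha, hb, fun e _ => hab e⟩
    obtain ⟨a, b, ha, hb, hab⟩ := hpair
    refine ⟨fun e => if s e = t e then 0 else a e, fun e => if s e = t e then 1 else b e,
      fun v => ?_, fun v => ?_, fun e he => ?_, fun e => ?_⟩
    · rw [← ha v]
      exact bdry_congr (fun e he => by simp [he]) v
    · rw [← hb v]
      exact bdry_congr (fun e he => by simp [he]) v
    · simp [hloop e he]
    · by_cases he : s e = t e
      · simp [he]
      · simpa [he] using hab e he

/-- Every graph without cuts of size one has a nowhere-zero flow over `ZMod 6`. -/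
theorem exists_nowhere_zero_flow [Fintype V] (n : ℕ) : ∀ (s t : E → V), #(nonloops s t) = n →
    (∀ S : Finset V, #(cut s t S) ≠ 1) →
    ∃ g : E → ZMod 6, (∀ v, bdry s t g v = 0) ∧ ∀ e, g e ≠ 0 := by
  induction n using Nat.strong_induction_on with
  | _ n ih =>
    intro s t hn h1
    by_cases h2 : ∃ S, #(cut s t S) = 2
    · obtain ⟨S, hS⟩ := h2
      obtain ⟨x, y, hxy, hSxy⟩ := Finset.card_eq_two.1 hS
      have hx : ¬(s x ∈ S ↔ t x ∈ S) := mem_cut.1 (by simp [hSxy])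
      have hy : ¬(s y ∈ S ↔ t y ∈ S) := mem_cut.1 (by simp [hSxy])
      have hne : s x ≠ t x := fun h => hx (by rw [h])
      let π : V → V := fun v => if v = t x then s x else v
      obtain ⟨g, hg, hg0⟩ := ih _
        (hn ▸ Finset.card_lt_card (nonloops_comp_ssubset (π := π) hne (by simp [π])))
        (π ∘ s) (π ∘ t) rfl (fun S => by rw [cut_comp]; exact h1 _)
      have hfib : ∀ w, w ≠ s x → w ≠ t x → univ.filter (fun v => π v = w) = {w} := by
        intro w hw1 hw2
        ext v
        simp only [Finset.mem_filter, Finset.mem_univ, true_and, Finset.mem_singleton, π]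
        split_ifs with h
        · exact ⟨fun h' => absurd h'.symm hw1, fun h' => absurd (h' ▸ h) hw2⟩
        · rfl
      have hfibx : univ.filter (fun v => π v = s x) = {s x, t x} := by
        ext v
        simp only [Finset.mem_filter, Finset.mem_univ, true_and, Finset.mem_singleton,
          Finset.mem_insert, π]
        split_ifs with h <;> simp [h]
      let d := bdry s t g (t x)
      let g' : E → ZMod 6 := g + Pi.single x d
      have hg' : ∀ v, bdry s t g' v = 0 := by
        intro v
        simp only [g', bdry_add, bdry_single]
        by_cases hv1 : v = t x
        · subst hv1; simp [hne, d]
        by_cases hv2 : v = s x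
        · subst hv2
          have := hg (s x)
          rw [bdry_comp, hfibx, Finset.sum_pair hne] at this
          simpa [hne.symm] using this
        · have := hg v
          rw [bdry_comp, hfib v hv2 hv1, Finset.sum_singleton] at this
          simp [this, Ne.symm hv1, Ne.symm hv2]
      refine ⟨g', hg', fun e => ?_⟩
      by_cases he : e = x
      · subst he
        intro h0
        have hsum : ∑ v ∈ S, bdry s t g' v = 0 := Finset.sum_eq_zero fun v _ => hg' v
        rw [sum_bdry, Finset.sum_eq_single y] at hsum
        · have hy0 : g' y = 0 := by
            by_cases a1 : s y ∈ S <;> by_cases a2 : t y ∈ S <;> simp_all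
          simp only [g', Pi.add_apply, Pi.single_eq_of_ne hxy.symm, add_zero] at hy0
          exact hg0 y hy0
        · intro e' _ he'
          by_cases he'' : e' = e
          · subst he''; simp [h0]
          · have : e' ∉ cut s t S := by simp [hSxy, he', he'']
            rw [mem_cut, not_not] at this
            simp [this]
        · simp
      · simpa [g', Pi.single_eq_of_ne he] using hg0 e
    · push Not at h2
      rcases isEmpty_or_nonempty V with hV | ⟨⟨u⟩⟩
      · exact ⟨1, fun v => isEmptyElim v, fun e => isEmptyElim (s e)⟩
      obtain ⟨a, b, ha, hb, -, hab⟩ := exists_flow_pair n s t hn (fun S => by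
        have := h1 S
        have := h2 S
        rw [← Finset.card_eq_zero]
        omega) u
      let φ : ZMod 2 →+ ZMod 6 :=
        ZMod.lift 2 ⟨(AddMonoidHom.mulLeft 3).comp (Int.castAddHom _), by decide⟩
      let ψ : ZMod 3 →+ ZMod 6 :=
        ZMod.lift 3 ⟨(AddMonoidHom.mulLeft 2).comp (Int.castAddHom _), by decide⟩
      have hφψ : ∀ x y, x ≠ 0 ∨ y ≠ 0 → φ x + ψ y ≠ 0 := by decide
      refine ⟨(fun e => φ (a e)) + fun e => ψ (b e), fun v => ?_, fun e => hφψ _ _ (hab e)⟩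
      rw [bdry_add, bdry_map, bdry_map, ha, hb, map_zero, map_zero, add_zero]

/-- A nowhere-zero flow over `ZMod k` lifts to an integral one with absolute values below `k`. -/
theorem exists_int_flow [Fintype V] {k : ℕ} [NeZero k] (s t : E → V) (g : E → ZMod k)
    (hg : ∀ v, bdry s t g v = 0) (hg0 : ∀ e, g e ≠ 0) :
    ∃ F : E → ℤ, (∀ v, bdry s t F v = 0) ∧ ∀ e, F e ≠ 0 ∧ |F e| < k := by
  let r : E → ℤ := fun e => ((g e).val : ℤ)
  have hr1 : ∀ e, 0 < r e := fun e => by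
    have := (ZMod.val_pos (n := k)).2 (hg0 e)
    simp only [r]; omega
  have hr2 : ∀ e, r e < k := fun e => by
    have := ZMod.val_lt (g e)
    simp only [r]; omega
  have hk : (0 : ℤ) < k := by exact_mod_cast Nat.pos_of_ne_zero (NeZero.ne k)
  have hdvd : ∀ v, ∃ c, bdry s t r v = k * c := by
    intro v
    rw [← dvd_def, ← ZMod.intCast_zmod_eq_zero_iff_dvd]
    have := bdry_map (Int.castAddHom (ZMod k)) s t r v
    simp only [Int.coe_castAddHom] at this
    rw [← this, ← hg v]
    simp [r]
  choose c hc using hdvd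
  have hcS : ∀ S : Finset V, (k : ℤ) * ∑ v ∈ S, c v = ∑ v ∈ S, bdry s t r v := fun S => by
    rw [Finset.mul_sum]
    exact Finset.sum_congr rfl fun v _ => (hc v).symm
  obtain ⟨q, hq1, hq2, hq⟩ := exists_bdry_eq s t (fun _ => -1) (fun _ => 0)
    (fun _ => by simp) (fun v => -c v)
    (by
      have := hcS univ
      rw [sum_bdry] at this
      simp only [Finset.mem_univ, if_true, sub_self, Finset.sum_const_zero, mul_eq_zero] at this
      rw [Finset.sum_neg_distrib, neg_eq_zero]
      exact this.resolve_left hk.ne')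
    (by
      intro S
      refine le_of_mul_le_mul_left ?_ hk
      rw [Finset.sum_neg_distrib, mul_neg, hcS, sum_bdry, ← Finset.sum_neg_distrib,
        Finset.mul_sum]
      refine Finset.sum_le_sum fun e _ => ?_
      have := hr1 e
      have := hr2 e
      by_cases a1 : s e ∈ S <;> by_cases a2 : t e ∈ S <;> simp [a1, a2] <;> omega)
  refine ⟨r + fun e => k * q e, fun v => ?_, fun e => ?_⟩
  · have := bdry_map (AddMonoidHom.mulLeft (k : ℤ)) s t q v
    simp only [AddMonoidHom.coe_mulLeft] at this
    rw [bdry_add, this, hq, hc]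
    ring
  · have h1 : -1 ≤ q e := hq1 e
    have h2 : q e ≤ 0 := hq2 e
    have h3 := hr1 e
    have h4 := hr2 e
    have h5 : q e = -1 ∨ q e = 0 := by omega
    rw [Pi.add_apply, abs_lt]
    rcases h5 with h5 | h5 <;> rw [h5] <;> refine ⟨?_, ?_, ?_⟩ <;> linarith

end Multigraph

/-- The first end of an edge, for an arbitrary choice of direction. -/
noncomputable def edgeFst {G : SimpleGraph V} (e : G.edgeSet) : V := (Quot.out e.1).1

/-- The second end of an edge, for an arbitrary choice of direction. -/
noncomputable def edgeSnd {G : SimpleGraph V} (e : G.edgeSet) : V := (Quot.out e.1).2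

lemma mk_edgeFst_edgeSnd {G : SimpleGraph V} (e : G.edgeSet) :
    s(edgeFst e, edgeSnd e) = e.1 := by
  simp [edgeFst, edgeSnd, Sym2.mk, Quot.out_eq]

lemma card_cut_ne_one [Fintype V] (G : SimpleGraph V)
    (hbr : ∀ e ∈ G.edgeSet, ¬ G.IsBridge e) (S : Finset V) :
    #(cut (edgeFst (G := G)) edgeSnd S) ≠ 1 := by
  intro h1
  obtain ⟨e, he⟩ := Finset.card_eq_one.1 h1
  have hcut : ∀ e', ¬(edgeFst e' ∈ S ↔ edgeSnd e' ∈ S) → e' = e := fun e' h => by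
    have : e' ∈ cut (edgeFst (G := G)) edgeSnd S := mem_cut.2 h
    simpa [he] using this
  have hee : ¬(edgeFst e ∈ S ↔ edgeSnd e ∈ S) := mem_cut.1 (by rw [he]; simp)
  have hne : ∀ u v, s(u, v) = e.1 → u ∈ S → v ∉ S → False := by
    intro u v huv hu hv
    refine hbr e.1 e.2 ?_
    rw [← huv, SimpleGraph.isBridge_iff]
    rintro ⟨p⟩
    obtain ⟨d, -, hd1, hd2⟩ := p.exists_boundary_dart (S : Set V) (by simpa) (by simpa)
    have hadj := d.adj
    rw [SimpleGraph.deleteEdges_adj] at hadj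
    refine hadj.2 (Set.mem_singleton_iff.2 (Eq.trans ?_ huv.symm))
    let e' : G.edgeSet := ⟨s(d.fst, d.snd), hadj.1⟩
    have h2 := mk_edgeFst_edgeSnd e'
    have h3 : e' = e := by
      refine hcut e' ?_
      simp only [Finset.mem_coe] at hd1 hd2
      rcases Sym2.eq_iff.1 h2 with ⟨h3, h4⟩ | ⟨h3, h4⟩ <;> rw [h3, h4] <;> tauto
    exact congrArg Subtype.val h3
  by_cases hs : edgeFst e ∈ S
  · exact hne _ _ (mk_edgeFst_edgeSnd e) hs fun h => hee ⟨fun _ => h, fun _ => hs⟩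
  · refine hne (edgeSnd e) (edgeFst e) ?_ (by tauto) hs
    rw [Sym2.eq_swap, mk_edgeFst_edgeSnd]

/-- **Seymour's 6-flow theorem**: a bridgeless graph has an integral flow with all absolute values
between one and five, here written as an antisymmetric function on pairs of vertices. -/
theorem exists_six_flow [Fintype V] (G : SimpleGraph V)
    (hbr : ∀ e ∈ G.edgeSet, ¬ G.IsBridge e) :
    ∃ φ : V → V → ℤ, (∀ u v, φ v u = -φ u v) ∧ (∀ u, ∑ v, φ u v = 0) ∧
      (∀ u v, ¬ G.Adj u v → φ u v = 0) ∧ ∀ u v, G.Adj u v → φ u v ≠ 0 ∧ |φ u v| ≤ 5 := by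
  let s : G.edgeSet → V := edgeFst
  let t : G.edgeSet → V := edgeSnd
  have hst : ∀ e : G.edgeSet, s(s e, t e) = e.1 := mk_edgeFst_edgeSnd
  obtain ⟨g, hg, hg0⟩ := exists_nowhere_zero_flow _ s t rfl (card_cut_ne_one G hbr)
  obtain ⟨F, hF, hF0⟩ := exists_int_flow s t g hg hg0
  let φ : V → V → ℤ := fun u v =>
    ∑ e, ((if s e = u ∧ t e = v then F e else 0) - (if t e = u ∧ s e = v then F e else 0))
  refine ⟨φ, fun u v => ?_, fun u => ?_, fun u v huv => ?_, fun u v huv => ?_⟩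
  · simp only [φ]
    rw [← Finset.sum_neg_distrib]
    refine Finset.sum_congr rfl fun e _ => ?_
    rw [neg_sub]
    congr 1 <;> exact if_congr and_comm rfl rfl
  · simp only [φ]
    rw [Finset.sum_comm]
    refine (Finset.sum_congr rfl fun e _ => ?_).trans (hF u)
    rw [Finset.sum_sub_distrib]
    congr 1
    · by_cases h : s e = u <;> simp [h]
    · by_cases h : t e = u <;> simp [h]
  · refine Finset.sum_eq_zero fun e _ => ?_
    have h1 : ¬(s e = u ∧ t e = v) := by
      rintro ⟨rfl, rfl⟩
      exact huv ((SimpleGraph.mem_edgeSet G).1 (hst e ▸ e.2))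
    have h2 : ¬(t e = u ∧ s e = v) := by
      rintro ⟨rfl, rfl⟩
      exact huv ((SimpleGraph.mem_edgeSet G).1 (hst e ▸ e.2)).symm
    simp [h1, h2]
  · let e₀ : G.edgeSet := ⟨s(u, v), huv⟩
    have hval : φ u v = F e₀ ∨ φ u v = -F e₀ := by
      have hφ : φ u v = (if s e₀ = u ∧ t e₀ = v then F e₀ else 0) -
          (if t e₀ = u ∧ s e₀ = v then F e₀ else 0) := by
        refine Finset.sum_eq_single e₀ (fun e _ he => ?_) (by simp)
        have h1 : ¬(s e = u ∧ t e = v) := by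
          rintro ⟨h1, h2⟩
          exact he (Subtype.ext (by rw [← hst e, h1, h2]))
        have h2 : ¬(t e = u ∧ s e = v) := by
          rintro ⟨h1, h2⟩
          exact he (Subtype.ext (by rw [← hst e, h1, h2, Sym2.eq_swap]))
        simp [h1, h2]
      rw [hφ]
      rcases Sym2.eq_iff.1 (hst e₀) with ⟨h1, h2⟩ | ⟨h1, h2⟩
      · simp [h1, h2, huv.ne, huv.ne']
      · simp [h1, h2, huv.ne, huv.ne']
    obtain ⟨h1, h2⟩ := hF0 e₀
    have h3 : |F e₀| ≤ 5 := by omega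
    rcases hval with h | h <;> rw [h]
    · exact ⟨h1, h3⟩
    · exact ⟨neg_ne_zero.2 h1, by rwa [abs_neg]⟩

/-- Three nonzero integers with sum zero have signs adding up to one in absolute value. -/
lemma abs_sum_sign_le_one {ι : Type*} (N : Finset ι) (hN : #N = 3) (φ : ι → ℤ)
    (h0 : ∀ y ∈ N, φ y ≠ 0) (hsum : ∑ y ∈ N, φ y = 0) : |∑ y ∈ N, (φ y).sign| ≤ 1 := by
  obtain ⟨a, b, c, hab, hac, hbc, rfl⟩ := Finset.card_eq_three.1 hN
  have hsum3 : ∀ f : ι → ℤ, ∑ y ∈ {a, b, c}, f y = f a + (f b + f c) := fun f => by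
    rw [Finset.sum_insert (by simp [hab, hac]), Finset.sum_pair hbc]
  rw [hsum3] at hsum ⊢
  have hsgn : ∀ y ∈ ({a, b, c} : Finset ι),
      (0 < φ y ∧ (φ y).sign = 1) ∨ (φ y < 0 ∧ (φ y).sign = -1) := fun y hy => by
    rcases lt_or_gt_of_ne (h0 y hy) with h | h
    · exact Or.inr ⟨h, Int.sign_eq_neg_one_of_neg h⟩
    · exact Or.inl ⟨h, Int.sign_eq_one_of_pos h⟩
  have ha := hsgn a (by simp)
  have hb := hsgn b (by simp)
  have hc := hsgn c (by simp)
  rw [abs_le]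
  omega

/-- The cubic case for graphs that need not be connected. -/
theorem hasFlow_of_forall_edge_not_isBridge [Fintype V] (G : SimpleGraph V) (hG : IsCubic G)
    (hbr : ∀ e ∈ G.edgeSet, ¬ G.IsBridge e) {r : ℝ} (hr2 : 2 ≤ r) (hr6 : r ≤ 6) :
    HasFlow G r ((6 - r) / 4) := by
  obtain ⟨φ, hanti, hsum, hnadj, hadj⟩ := exists_six_flow G hbr
  have hadj_of : ∀ u v, φ u v ≠ 0 → G.Adj u v := fun u v h => by
    by_contra hn
    exact h (hnadj u v hn)
  let c : ℝ := (r - 2) / 4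
  have hc0 : 0 ≤ c := by simp only [c]; linarith
  let D : Orientation G :=
    { dir := fun u v => 0 < φ u v
      adj_of_dir := fun u v h => hadj_of u v h.ne'
      dir_iff_not := fun u v h => by
        have := (hadj u v h).1
        rw [hanti u v]
        omega }
  let f : Sym2 V → ℝ := Sym2.lift ⟨fun u v => 1 + c * ((|φ u v| : ℤ) - 1), fun u v => by
    simp only [hanti u v, abs_neg]⟩
  have hf : ∀ u v, f s(u, v) = 1 + c * ((|φ u v| : ℤ) - 1) := fun u v => rfl
  refine ⟨D, f, fun e he => ?_, fun x => ?_⟩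
  · induction e using Sym2.ind with
    | _ u v =>
      obtain ⟨h0, h5⟩ := hadj u v he
      have h1 : (1 : ℝ) ≤ (|φ u v| : ℤ) := by exact_mod_cast Int.one_le_abs h0
      have h5' : ((|φ u v| : ℤ) : ℝ) ≤ 5 := by exact_mod_cast h5
      rw [hf]
      constructor
      · nlinarith
      · have : c * ((|φ u v| : ℤ) - 1) ≤ c * 4 := by gcongr; linarith
        simp only [c] at this ⊢
        linarith
  · have hterm : excess D f x = ∑ y, ((1 - c) * ((φ x y).sign : ℝ) + c * (φ x y : ℝ)) := by
      rw [excess, ← Finset.sum_sub_distrib]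
      refine Finset.sum_congr rfl fun y _ => ?_
      have h1 : D.dir x y ↔ 0 < φ x y := Iff.rfl
      have h2 : D.dir y x ↔ φ x y < 0 := by
        change 0 < φ y x ↔ _
        rw [hanti x y]
        omega
      simp only [h1, h2, hf]
      rcases lt_trichotomy (φ x y) 0 with h | h | h
      · rw [if_neg (by omega), if_pos h, abs_of_neg h, Int.sign_eq_neg_one_of_neg h]
        push_cast
        ring
      · simp [h]
      · rw [if_pos h, if_neg (by omega), abs_of_pos h, Int.sign_eq_one_of_pos h]
        push_cast
        ring
    have hexc : excess D f x = (1 - c) * ((∑ y, (φ x y).sign : ℤ) : ℝ) := by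
      have h0 : ((∑ y, φ x y : ℤ) : ℝ) = 0 := by rw [hsum x]; simp
      push_cast at h0 ⊢
      rw [hterm, Finset.sum_add_distrib, ← Finset.mul_sum, ← Finset.mul_sum, h0]
      ring
    have hN : #(univ.filter fun y => G.Adj x y) = 3 := by
      rw [← hG x, ← Set.ncard_coe_finset]
      congr 1
      ext y
      simp
    have hout : ∀ ψ : ℤ → ℤ, ψ 0 = 0 →
        ∑ y ∈ univ.filter (fun y => G.Adj x y), ψ (φ x y) = ∑ y, ψ (φ x y) := fun ψ hψ => by
      refine Finset.sum_subset (Finset.filter_subset _ _) fun y _ hy => ?_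
      rw [hnadj x y (by simpa using hy), hψ]
    have habs := abs_sum_sign_le_one _ hN (φ x) (fun y hy => (hadj x y (by simpa using hy)).1)
      ((hout id rfl).trans (hsum x))
    rw [hout Int.sign rfl] at habs
    have habs' : |((∑ y, (φ x y).sign : ℤ) : ℝ)| ≤ 1 := by exact_mod_cast habs
    have hc1 : 1 - c = (6 - r) / 4 := by simp only [c]; ring
    have hα : 0 ≤ (6 - r) / 4 := by linarith
    rw [hexc, hc1, abs_mul, abs_of_nonneg hα]
    exact mul_le_of_le_one_right hα habs'

/-- every bridgeless cubic graph admits an `(r, (6-r)/4)`-flow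
for every `2 ≤ r ≤ 6`. -/
theorem stmt14 [Fintype V] (G : SimpleGraph V) (hG : IsCubic G)
    (hbr : ∀ e : Sym2 V, ¬ G.IsBridge e) :
    ∀ r : ℝ, 2 ≤ r → r ≤ 6 → HasFlow G r ((6 - r) / 4) := by
  exact fun r hr2 hr6 => hasFlow_of_forall_edge_not_isBridge G hG (fun e _ => hbr e) hr2 hr6

end BEF
end

section
/- If a cubic graph G admits an (s,0)-flow for some real s with 2≤s<5 (in particular, if the circular flow number of G is strictly smaller than 5), then G admits a (3+1/3, 1/3)-flow. -/
open Finset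
open scoped Classical

namespace BEF

variable {V : Type*}

/-- Round a flow value in `[1, 4)` to one of the three levels `1`, `5/3`, `7/3`. -/
noncomputable def threeLevel (t : ℝ) : ℝ :=
  if t < 2 then 1 else if t < 3 then 5 / 3 else 7 / 3

lemma one_le_threeLevel (t : ℝ) : 1 ≤ threeLevel t := by
  unfold threeLevel
  split_ifs <;> norm_num

lemma threeLevel_le (t : ℝ) : threeLevel t ≤ 7 / 3 := by
  unfold threeLevel
  split_ifs <;> norm_num

/-- `threeLevel` is additive up to an error of `1/3` as long as the sum stays below `4`. -/
lemma abs_threeLevel_add_sub_le {a b c : ℝ} (ha : 1 ≤ a) (hb : 1 ≤ b) (hc : c < 4)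
    (h : a + b = c) : |threeLevel a + threeLevel b - threeLevel c| ≤ 1 / 3 := by
  unfold threeLevel
  rw [abs_le]
  split_ifs <;> constructor <;> linarith

/-- Signed contribution of the edge `xy` to the excess at `x`. -/
noncomputable def signedFlow {G : SimpleGraph V} (D : Orientation G) (f : Sym2 V → ℝ)
    (x y : V) : ℝ :=
  if D.dir x y then f s(x, y) else -f s(x, y)

lemma excess_eq_sum_neighbors [Fintype V] {G : SimpleGraph V} (D : Orientation G)
    (f : Sym2 V → ℝ) (x : V) (S : Finset V) (hS : ∀ y, y ∈ S ↔ G.Adj x y) :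
    excess D f x = ∑ y ∈ S, signedFlow D f x y := by
  unfold excess
  rw [← Finset.sum_sub_distrib]
  symm
  have houtside : ∀ y ∈ (Finset.univ : Finset V), y ∉ S →
      ((if D.dir x y then f s(x, y) else 0) - if D.dir y x then f s(x, y) else 0) = 0 := by
    intro y _ hy
    have hxy : ¬ D.dir x y := fun hd => hy ((hS y).2 (D.adj_of_dir _ _ hd))
    have hyx : ¬ D.dir y x := fun hd => hy ((hS y).2 (D.adj_of_dir _ _ hd).symm)
    simp [hxy, hyx]
  rw [← Finset.sum_subset (Finset.subset_univ S) houtside]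
  refine Finset.sum_congr rfl fun y hy => ?_
  have hd := D.dir_iff_not x y ((hS y).1 hy)
  unfold signedFlow
  by_cases hyx : D.dir y x <;> simp [hd, hyx]

/-- a cubic graph with an `(s, 0)`-flow for some `2 ≤ s < 5`
admits a `(3 + 1/3, 1/3)`-flow. -/
theorem stmt15 [Fintype V] (G : SimpleGraph V) (hG : IsCubic G)
    (s : ℝ) (hs2 : 2 ≤ s) (hs5 : s < 5) (h : HasFlow G s 0) :
    HasFlow G (3 + 1 / 3) (1 / 3) := by
  obtain ⟨D, f, hf, hx⟩ := h
  refine ⟨D, fun e => threeLevel (f e), fun e _ => ⟨one_le_threeLevel _, ?_⟩, fun x => ?_⟩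
  · have := threeLevel_le (f e)
    norm_num
    linarith
  obtain ⟨a, b, c, hab, hac, hbc, hN⟩ := Set.ncard_eq_three.1 (hG x)
  have hS : ∀ y, y ∈ ({a, b, c} : Finset V) ↔ G.Adj x y := by
    intro y
    rw [← SimpleGraph.mem_neighborSet, hN]
    simp
  have hbound : ∀ y ∈ ({a, b, c} : Finset V), 1 ≤ f s(x, y) ∧ f s(x, y) < 4 := by
    intro y hy
    obtain ⟨hl, hu⟩ := hf s(x, y) ((hS y).1 hy)
    exact ⟨hl, by linarith⟩
  have hsum : ∀ g : V → ℝ, ∑ y ∈ ({a, b, c} : Finset V), g y = g a + (g b + g c) := by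
    intro g
    rw [Finset.sum_insert (by simp [hab, hac]), Finset.sum_pair hbc]
  have h0 : excess D f x = 0 := abs_nonpos_iff.1 (hx x)
  rw [excess_eq_sum_neighbors D _ x _ hS, hsum] at h0 ⊢
  obtain ⟨hla, hua⟩ := hbound a (by simp)
  obtain ⟨hlb, hub⟩ := hbound b (by simp)
  obtain ⟨hlc, huc⟩ := hbound c (by simp)
  unfold signedFlow at h0 ⊢
  have key := @abs_threeLevel_add_sub_le
  simp only [abs_le] at key ⊢
  split_ifs at h0 ⊢
  · linarith
  · have := key hla hlb huc (by linarith)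
    constructor <;> linarith
  · have := key hla hlc hub (by linarith)
    constructor <;> linarith
  · have := key hlb hlc hua (by linarith)
    constructor <;> linarith
  · have := key hlb hlc hua (by linarith)
    constructor <;> linarith
  · have := key hla hlc hub (by linarith)
    constructor <;> linarith
  · have := key hla hlb huc (by linarith)
    constructor <;> linarith
  · linarith

end BEF
end

section
/- Every cubic graph admits a (3+1/2, 1/2)-flow. -/
open Finset
open scoped Classical

namespace BEF

variable {V : Type*}

/-- A fixed-point-free pair of involutions admits a common `Bool`-valued sign changed by both. -/
lemma exists_sign_of_fixedPointFree {X : Type*} (α β : Equiv.Perm X)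
    (hα : ∀ x, α (α x) = x) (hβ : ∀ x, β (β x) = x)
    (hα' : ∀ x, α x ≠ x) (hβ' : ∀ x, β x ≠ x) :
    ∃ s : X → Bool, (∀ x, s (α x) = !s x) ∧ ∀ x, s (β x) = !s x := by
  have hα1 : α⁻¹ = α := by
    ext x; rw [Equiv.Perm.inv_eq_iff_eq, hα]
  have hβ1 : β⁻¹ = β := by
    ext x; rw [Equiv.Perm.inv_eq_iff_eq, hβ]
  set ρ := α * β with hρ
  have hconj : ∀ i : ℤ, α * ρ ^ i = ρ ^ (-i) * α := by
    intro i
    have h1 : α * ρ * α⁻¹ = ρ⁻¹ := by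
      rw [hρ, mul_inv_rev, hβ1, hα1, ← mul_assoc]
      ext x; simp [hα]
    have h2 : α * ρ ^ i * α⁻¹ = ρ ^ (-i) := by
      rw [← conj_zpow, h1, zpow_neg, inv_zpow]
    rw [← h2]; group
  have hnot : ∀ x, ¬ ρ.SameCycle x (α x) := by
    rintro x ⟨i, hi⟩
    rcases Int.even_or_odd' i with ⟨j, rfl | rfl⟩
    · apply hα' ((ρ ^ j) x)
      have := congrArg (fun p => p x) (hconj j)
      simp only [Equiv.Perm.mul_apply] at this
      rw [this, ← hi, ← Equiv.Perm.mul_apply, ← zpow_add]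
      congr 2; ring
    · apply hβ' ((ρ ^ j) x)
      have := congrArg (fun p => p x) (hconj j)
      simp only [Equiv.Perm.mul_apply] at this
      rw [← hi, ← Equiv.Perm.mul_apply (ρ ^ (-j)), ← zpow_add] at this
      have h3 : (ρ ^ (-j + (2 * j + 1))) x = α (β ((ρ ^ j) x)) := by
        have : -j + (2 * j + 1) = 1 + j := by ring
        rw [this, zpow_add, zpow_one]; rfl
      rw [h3] at this
      exact (α.injective this).symm
  let S : Setoid X := Equiv.Perm.SameCycle.setoid ρ
  let A : Quotient S → Quotient S := Quotient.map α (by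
    rintro x y ⟨i, hi⟩
    refine ⟨-i, ?_⟩
    have := congrArg (fun p => p x) (hconj i)
    simp only [Equiv.Perm.mul_apply] at this
    rw [← this, hi])
  have hA : ∀ q, A (A q) = q := by
    intro q; induction q using Quotient.inductionOn with
    | h x => simp [A, hα]
  have hA' : ∀ q, A q ≠ q := by
    intro q; induction q using Quotient.inductionOn with
    | h x =>
      intro h
      exact hnot x (Quotient.exact h).symm
  have hβA : ∀ x, (⟦β x⟧ : Quotient S) = A ⟦x⟧ := by
    intro x
    apply Quotient.sound
    exact ⟨1, by rw [zpow_one, hρ, Equiv.Perm.mul_apply, hβ]⟩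
  let lt : Quotient S → Quotient S → Prop := WellOrderingRel
  have key : ∀ q, decide (lt (A q) (A (A q))) = !decide (lt q (A q)) := by
    intro q
    rw [hA]
    rcases trichotomous_of lt q (A q) with h | h | h
    · have h' : ¬ lt (A q) q := asymm_of lt h
      simp [h, h']
    · exact absurd h.symm (hA' q)
    · have h' : ¬ lt q (A q) := asymm_of lt h
      simp [h, h']
  refine ⟨fun x => decide (lt ⟦x⟧ (A ⟦x⟧)), fun x => key ⟦x⟧, fun x => ?_⟩
  simp only [hβA]
  exact key ⟦x⟧

/-- The union of two partial matchings is bipartite. -/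
lemma exists_sign_of_involutive {X : Type*} (α β : X → X)
    (hα : ∀ x, α (α x) = x) (hβ : ∀ x, β (β x) = x) :
    ∃ s : X → Bool, (∀ x, α x ≠ x → s (α x) ≠ s x) ∧ ∀ x, β x ≠ x → s (β x) ≠ s x := by
  have lift : ∀ γ : X → X, (∀ x, γ (γ x) = x) → ∃ γ' : Equiv.Perm (X × Bool),
      (∀ p, γ' (γ' p) = p) ∧ (∀ p, γ' p ≠ p) ∧ ∀ x b, γ x ≠ x → γ' (x, b) = (γ x, b) := by
    intro γ hγ
    let f : X × Bool → X × Bool := fun p => if γ p.1 = p.1 then (p.1, !p.2) else (γ p.1, p.2)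
    have hf : Function.Involutive f := by
      rintro ⟨x, b⟩
      by_cases h : γ x = x
      · simp [f, h]
      · have : γ (γ x) ≠ γ x := by rw [hγ]; exact fun h' => h h'.symm
        simp [f, h, hγ, Ne.symm h]
    refine ⟨hf.toPerm, hf, ?_, ?_⟩
    · rintro ⟨x, b⟩
      by_cases h : γ x = x <;> simp [f, h, Function.Involutive.toPerm]
    · intro x b h
      simp [f, h]
  obtain ⟨α', h1, h2, h3⟩ := lift α hα
  obtain ⟨β', g1, g2, g3⟩ := lift β hβ
  obtain ⟨s, hs, hs'⟩ := exists_sign_of_fixedPointFree α' β' h1 g1 h2 g2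
  refine ⟨fun x => s (x, false), fun x hx => ?_, fun x hx => ?_⟩
  · have := hs (x, false)
    rw [h3 _ _ hx] at this
    simp [this]
  · have := hs' (x, false)
    rw [g3 _ _ hx] at this
    simp [this]

/-- Two symmetric relations, each relating every element to at most one other element, can be
properly 2-coloured simultaneously. -/
lemma exists_sign_of_matchings {X : Type*} (R₁ R₂ : X → X → Prop)
    (s₁ : ∀ x y, R₁ x y → R₁ y x) (s₂ : ∀ x y, R₂ x y → R₂ y x)
    (i₁ : ∀ x, ¬ R₁ x x) (i₂ : ∀ x, ¬ R₂ x x)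
    (u₁ : ∀ x y z, R₁ x y → R₁ x z → y = z) (u₂ : ∀ x y z, R₂ x y → R₂ x z → y = z) :
    ∃ s : X → Bool, (∀ x y, R₁ x y → s x ≠ s y) ∧ ∀ x y, R₂ x y → s x ≠ s y := by
  have inv : ∀ R : X → X → Prop, (∀ x y, R x y → R y x) → (∀ x y z, R x y → R x z → y = z) →
      ∃ γ : X → X, (∀ x, γ (γ x) = x) ∧ ∀ x y, R x y → γ x = y := by
    intro R hs hu
    let γ : X → X := fun x => if h : ∃ y, R x y then h.choose else x
    have hγ : ∀ x y, R x y → γ x = y := by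
      intro x y h
      have h' : ∃ y, R x y := ⟨y, h⟩
      simp only [γ, h', dif_pos]
      exact hu _ _ _ h'.choose_spec h
    refine ⟨γ, fun x => ?_, hγ⟩
    by_cases h : ∃ y, R x y
    · obtain ⟨y, hy⟩ := h
      rw [hγ x y hy, hγ y x (hs _ _ hy)]
    · have : γ x = x := by simp only [γ, h, dif_neg, not_false_eq_true]
      rw [this, this]
  obtain ⟨α, hα, hα'⟩ := inv R₁ s₁ u₁
  obtain ⟨β, hβ, hβ'⟩ := inv R₂ s₂ u₂
  obtain ⟨s, h1, h2⟩ := exists_sign_of_involutive α β hα hβ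
  refine ⟨s, fun x y h => ?_, fun x y h => ?_⟩
  · have := h1 x (by rw [hα' x y h]; rintro rfl; exact i₁ _ h)
    rw [hα' x y h] at this
    exact this.symm
  · have := h2 x (by rw [hβ' x y h]; rintro rfl; exact i₂ _ h)
    rw [hβ' x y h] at this
    exact this.symm

/-- Greedy colouring: a symmetric relation of degree at most two has a proper 3-colouring. -/
lemma exists_three_coloring {E : Type*} [Fintype E] (R : E → E → Prop)
    (hs : ∀ x y, R x y → R y x) (hi : ∀ x, ¬ R x x)
    (hd : ∀ x, #{y | R x y} ≤ 2) : ∃ κ : E → Fin 3, ∀ x y, R x y → κ x ≠ κ y := by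
  suffices h : ∀ s : Finset E, ∃ κ : E → Fin 3, ∀ x ∈ s, ∀ y ∈ s, R x y → κ x ≠ κ y by
    obtain ⟨κ, hκ⟩ := h univ
    exact ⟨κ, fun x y => hκ x (mem_univ _) y (mem_univ _)⟩
  intro s
  induction s using Finset.induction_on with
  | empty => exact ⟨fun _ => 0, by simp⟩
  | insert a s ha ih =>
    obtain ⟨κ, hκ⟩ := ih
    obtain ⟨i, hi'⟩ : ∃ i : Fin 3, i ∉ ({y | R a y} : Finset E).image κ := by
      by_contra hcon
      push Not at hcon
      have h1 : (univ : Finset (Fin 3)) ⊆ ({y | R a y} : Finset E).image κ := fun i _ => hcon i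
      have h2 := card_le_card h1
      have h3 := (card_image_le (s := ({y | R a y} : Finset E)) (f := κ)).trans (hd a)
      simp at h2
      omega
    have hi2 : ∀ y, R a y → i ≠ κ y := by
      rintro y hy rfl
      exact hi' (mem_image_of_mem _ (by simpa using hy))
    refine ⟨Function.update κ a i, fun x hx y hy hxy => ?_⟩
    by_cases hxa : x = a
    · subst hxa
      have hyx : y ≠ x := by rintro rfl; exact hi _ hxy
      simpa [hyx] using hi2 y hxy
    · by_cases hya : y = a
      · subst hya
        simpa [hxa] using (hi2 x (hs _ _ hxy)).symm
      · simp only [Function.update_of_ne hxa, Function.update_of_ne hya]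
        exact hκ x (mem_of_mem_insert_of_ne hx hxa) y (mem_of_mem_insert_of_ne hy hya) hxy

/-- Label the arcs `v → π v` of the cycles of a permutation by `0, 1` alternately, with a
single arc of each odd cycle labelled `2`; the head of that arc is `P`-marked whenever the
cycle has a `P`-marked element. -/
lemma exists_arc_labels {V : Type*} [Fintype V] (π : Equiv.Perm V) (P : V → Prop) :
    ∃ l : V → Fin 3, ∀ v, π v ≠ v →
      (l v = 0 → l (π v) = 1) ∧ (l v = 1 → l (π v) ≠ 1) ∧
      (l v = 2 → l (π v) = 0 ∧ (P (π v) ∨ ∀ w, π.SameCycle v w → ¬ P w)) := by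
  let S : Setoid V := Equiv.Perm.SameCycle.setoid π
  have hbase : ∀ q : Quotient S, ∃ x : V, ⟦x⟧ = q ∧ (P x ∨ ∀ w, ⟦w⟧ = q → ¬ P w) := by
    intro q
    by_cases h : ∃ x : V, ⟦x⟧ = q ∧ P x
    · obtain ⟨x, hx, hP⟩ := h
      exact ⟨x, hx, Or.inl hP⟩
    · obtain ⟨x, hx⟩ := q.exists_rep
      push Not at h
      exact ⟨x, hx, Or.inr h⟩
  choose b hb1 hb2 using hbase
  have hreach : ∀ v, ∃ i : ℕ, (π ^ i) (b ⟦v⟧) = v := by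
    intro v
    have : π.SameCycle (b ⟦v⟧) v := Quotient.exact (hb1 ⟦v⟧)
    obtain ⟨i, hi⟩ := this.exists_nat_pow_eq
    exact ⟨i, hi⟩
  let idx : V → ℕ := fun v => Nat.find (hreach v)
  have hclass : ∀ v, (⟦π v⟧ : Quotient S) = ⟦v⟧ := by
    intro v
    exact Quotient.sound (show π.SameCycle (π v) v from ⟨-1, by simp⟩)
  have hidx : ∀ v, (π ^ idx v) (b ⟦v⟧) = v := fun v => Nat.find_spec (hreach v)
  have hidx_le : ∀ v i, (π ^ i) (b ⟦v⟧) = v → idx v ≤ i := fun v i h => Nat.find_min' _ h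
  have hbzero : ∀ v, v = b ⟦v⟧ → idx v = 0 := by
    intro v h
    have := hidx_le v 0 (by simpa using h.symm)
    omega
  have hsucc : ∀ v, π v ≠ b ⟦v⟧ → idx (π v) = idx v + 1 := by
    intro v hv
    apply le_antisymm
    · apply hidx_le
      rw [hclass, pow_succ', Equiv.Perm.mul_apply, hidx]
    · have h1 := hidx (π v)
      rw [hclass] at h1
      obtain ⟨j, hj⟩ : ∃ j, idx (π v) = j + 1 := by
        apply Nat.exists_eq_succ_of_ne_zero
        intro h0
        rw [h0] at h1
        exact hv (by simpa using h1.symm)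
      rw [hj, pow_succ', Equiv.Perm.mul_apply] at h1
      have := hidx_le v j (π.injective h1)
      omega
  refine ⟨fun v => if Even (idx v) then (if π v = b ⟦v⟧ then 2 else 0) else 1, fun v hv => ?_⟩
  by_cases hvb : π v = b ⟦v⟧
  · have h0 : idx (π v) = 0 := hbzero _ (by rw [hclass]; exact hvb)
    have hne : π (π v) ≠ b ⟦π v⟧ := by
      rw [hclass, ← hvb]
      exact fun h => hv (π.injective h)
    by_cases he : Even (idx v)
    · simp only [he, hvb, if_true]
      rw [hvb] at h0 hne
      refine ⟨fun h => absurd h (by decide), fun h => absurd h (by decide),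
        fun _ => ⟨by simp [h0, hne], ?_⟩⟩
      rcases hb2 ⟦v⟧ with h | h
      · exact Or.inl h
      · exact Or.inr fun w hw => h w (Quotient.sound hw.symm)
    · simp [he, h0, hne]
  · have h1 := hsucc v hvb
    by_cases he : Even (idx v)
    · simp [he, hvb, h1, Nat.even_add_one]
    · simp only [he, h1, Nat.even_add_one, if_false]
      refine ⟨fun h => absurd h (by decide), fun _ => ?_, fun h => absurd h (by decide)⟩
      simp only [not_false_eq_true, if_true]
      split_ifs <;> decide

lemma even_sum_sum_of_symm {Y : Type*} (w : Y → Y → ℕ) (hs : ∀ x y, w x y = w y x)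
    (hd : ∀ x, w x x = 0) (K : Finset Y) : Even (∑ x ∈ K, ∑ y ∈ K, w x y) := by
  induction K using Finset.induction_on with
  | empty => simp
  | insert a K ha ih =>
    have h1 : ∑ x ∈ K, w x a = ∑ x ∈ K, w a x := sum_congr rfl fun x _ => hs x a
    simp only [sum_insert ha, hd, sum_add_distrib, h1, zero_add]
    rw [← add_assoc]
    exact (Even.add_self _).add ih

/-- A weighted version of Petersen's theorem: `w` are edge multiplicities, `e y` counts further
half-edges at `y`. -/
lemma exists_matching_of_weights {Y : Type*} [Fintype Y] (w : Y → Y → ℕ) (e : Y → ℕ)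
    (hs : ∀ x y, w x y = w y x) (hd : ∀ x, w x x = 0) (hsum : ∀ y, ∑ z, w y z + e y = 3)
    (he : ∑ y, e y = 0 ∨ ∑ y, e y = 2)
    (hcut : ∀ K : Finset Y, ∑ y ∈ K, (∑ z ∈ Kᶜ, w y z + e y) ≠ 1) :
    ∃ μ : Y → Y, (∀ y, μ (μ y) = y) ∧ ∀ y, w y (μ y) ≠ 0 := by
  let Γ : SimpleGraph Y :=
    { Adj := fun y z => w y z ≠ 0
      symm := ⟨fun y z h => by rwa [hs]⟩
      loopless := ⟨fun y h => h (hd y)⟩ }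
  have htutte : ∃ M : Γ.Subgraph, M.IsPerfectMatching := by
    rw [SimpleGraph.tutte]
    intro S hS
    unfold SimpleGraph.IsTutteViolator at hS
    set Δ := ((⊤ : Γ.Subgraph).deleteVerts S) with hΔ
    have hmem : ∀ y, y ∈ Δ.verts ↔ y ∉ S := by intro y; simp [hΔ]
    set q := Δ.coe.oddComponents.ncard with hq
    have hY : Even (Fintype.card Y) := by
      have h1 : ∑ y : Y, (∑ z, w y z + e y) = 3 * Fintype.card Y := by
        simp [hsum, mul_comm]
      rw [sum_add_distrib] at h1
      have h2 := even_sum_sum_of_symm w hs hd univ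
      have h3 : Even (∑ y, e y) := by rcases he with h | h <;> rw [h] <;> decide
      have h4 : Even (3 * Fintype.card Y) := h1 ▸ h2.add h3
      rcases Nat.even_mul.1 h4 with h | h
      · exact absurd h (by decide)
      · exact h
    have hcard : Nat.card Δ.verts + S.ncard = Fintype.card Y := by
      have : Δ.verts = Sᶜ := by ext y; simp [hmem]
      rw [this, Nat.card_coe_set_eq, add_comm, Set.ncard_add_ncard_compl, Nat.card_eq_fintype_card]
    have hpar := SimpleGraph.odd_ncard_oddComponents Δ.coe
    have hq2 : S.ncard + 2 ≤ q := by
      have : ¬ q = S.ncard + 1 := by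
        intro h
        rw [← hq, h] at hpar
        rw [← hcard] at hY
        rcases Nat.even_or_odd S.ncard with h5 | h5
        · have := hpar.1 h5.add_one
          exact absurd hY (Nat.not_even_iff_odd.2 (this.add_even h5))
        · have h6 : ¬ Odd (Nat.card Δ.verts) := fun h' =>
            absurd (hpar.2 h') (Nat.not_odd_iff_even.2 h5.add_one)
          exact absurd hY (Nat.not_even_iff_odd.2 ((Nat.not_odd_iff_even.1 h6).add_odd h5))
      omega
    let g : Y → ℕ := fun y => ∑ z ∈ S.toFinset, w y z + e y
    have hcomp : ∀ c ∈ Δ.coe.oddComponents,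
        3 ≤ ∑ v : Δ.verts with Δ.coe.connectedComponentMk v = c, g v := by
      intro c hc
      let K : Finset Y := ({v : Δ.verts | Δ.coe.connectedComponentMk v = c} : Finset _).map
        ⟨Subtype.val, Subtype.val_injective⟩
      have hKmem : ∀ y, y ∈ K ↔ ∃ h : y ∈ Δ.verts, Δ.coe.connectedComponentMk ⟨y, h⟩ = c := by
        intro y; simp [K]
      have hKg : ∑ v : Δ.verts with Δ.coe.connectedComponentMk v = c, g v = ∑ y ∈ K, g y := by
        simp [K]
      have hKodd : Odd #K := by
        have : #K = c.supp.ncard := by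
          rw [Set.ncard_eq_toFinset_card', card_map]
          congr 1
          ext v
          simp
        rw [this]
        exact hc
      have hKout : ∑ y ∈ K, g y = ∑ y ∈ K, (∑ z ∈ Kᶜ, w y z + e y) := by
        refine sum_congr rfl fun y hy => ?_
        simp only [g]
        congr 1
        apply sum_subset
        · intro z hz
          rw [mem_compl, hKmem]
          rintro ⟨h, -⟩
          exact (hmem z).1 h (by simpa using hz)
        · intro z hz hzS
          by_contra hw
          rw [mem_compl] at hz
          apply hz
          obtain ⟨hy1, hy2⟩ := (hKmem y).1 hy
          have hz1 : z ∈ Δ.verts := (hmem z).2 (by simpa using hzS)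
          rw [hKmem]
          refine ⟨hz1, ?_⟩
          rw [← hy2]
          apply SimpleGraph.ConnectedComponent.sound
          apply SimpleGraph.Adj.reachable
          have hyS := (hmem y).1 hy1
          have hzS' := (hmem z).1 hz1
          have : Γ.Adj z y := by
            change w z y ≠ 0
            rwa [hs]
          simp [hΔ, hyS, hzS', this]
      rw [hKg, hKout]
      have h1 : ∑ y ∈ K, ∑ z ∈ K, w y z + ∑ y ∈ K, (∑ z ∈ Kᶜ, w y z + e y) = 3 * #K := by
        rw [← sum_add_distrib]
        have : ∀ y ∈ K, ∑ z ∈ K, w y z + (∑ z ∈ Kᶜ, w y z + e y) = 3 := by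
          intro y _
          rw [← add_assoc, sum_add_sum_compl, hsum]
        rw [sum_congr rfl this]
        simp [mul_comm]
      have h2 := even_sum_sum_of_symm w hs hd K
      have h3 := hcut K
      obtain ⟨a, ha⟩ := h2
      obtain ⟨b, hb⟩ := hKodd
      omega
    have hlow : 3 * q ≤ ∑ v : Δ.verts, g v := by
      rw [← sum_fiberwise univ (fun v => Δ.coe.connectedComponentMk v) (fun v => g v)]
      calc 3 * q = ∑ c ∈ Δ.coe.oddComponents.toFinset, 3 := by
            rw [sum_const, hq, Set.ncard_eq_toFinset_card']; simp [mul_comm]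
        _ ≤ ∑ c ∈ Δ.coe.oddComponents.toFinset,
              ∑ v : Δ.verts with Δ.coe.connectedComponentMk v = c, g v :=
            sum_le_sum fun c hc => hcomp c (by simpa using hc)
        _ ≤ _ := sum_le_sum_of_subset (subset_univ _)
    have hup : ∑ v : Δ.verts, g v ≤ 3 * S.ncard + 2 := by
      calc ∑ v : Δ.verts, g v ≤ ∑ y, g y := by
            rw [← sum_subtype (univ.filter (· ∈ Δ.verts)) (by simp) g]
            exact sum_le_sum_of_subset (subset_univ _)
        _ = ∑ z ∈ S.toFinset, ∑ y, w y z + ∑ y, e y := by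
            simp only [g, sum_add_distrib]
            rw [sum_comm]
        _ ≤ ∑ z ∈ S.toFinset, 3 + 2 := by
            apply add_le_add
            · refine sum_le_sum fun z _ => ?_
              have h1 : ∑ y, w y z = ∑ y, w z y := sum_congr rfl fun y _ => hs y z
              have := hsum z
              omega
            · omega
        _ = 3 * S.ncard + 2 := by rw [sum_const, Set.ncard_eq_toFinset_card']; simp [mul_comm]
    omega
  obtain ⟨M, hM, hspan⟩ := htutte
  have hex : ∀ y, ∃! z, M.Adj y z := fun y => hM (hspan y)
  choose μ hμ hμ' using hex
  exact ⟨μ, fun y => (hμ' _ _ (hμ y).symm).symm, fun y => (hμ y).adj_sub⟩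

/-- The neighbours of a vertex, as a finset. -/
noncomputable def nbrs {V : Type*} [Fintype V] (H : SimpleGraph V) (v : V) : Finset V :=
  {w | H.Adj v w}

lemma mem_nbrs {V : Type*} [Fintype V] {H : SimpleGraph V} {v w : V} :
    w ∈ nbrs H v ↔ H.Adj v w := by
  simp [nbrs]

/-- No set of vertices is left by exactly one edge, and all degrees are at most three. -/
structure Bridgeless {V : Type*} [Fintype V] (H : SimpleGraph V) : Prop where
  card_le : ∀ v, #(nbrs H v) ≤ 3
  cut_ne : ∀ X : Finset V, ∑ x ∈ X, #(nbrs H x \ X) ≠ 1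

lemma Bridgeless.card_eq {V : Type*} [Fintype V] {H : SimpleGraph V} (hH : Bridgeless H)
    {v w : V} (h : H.Adj v w) : #(nbrs H v) = 2 ∨ #(nbrs H v) = 3 := by
  have h1 := hH.card_le v
  have h2 := hH.cut_ne {v}
  have h3 : nbrs H v \ {v} = nbrs H v := by
    rw [sdiff_singleton_eq_erase, erase_eq_of_notMem]
    simp [mem_nbrs]
  simp only [sum_singleton, h3] at h2
  have h4 : 0 < #(nbrs H v) := card_pos.2 ⟨w, mem_nbrs.2 h⟩
  omega

/-- In a bridgeless subcubic graph one can select edges so that every vertex of degree three is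
on exactly one of them, every vertex of degree two is on none or two of them, and a prescribed
vertex of degree two is on none. -/
lemma Bridgeless.exists_matching {V : Type*} [Fintype V] {H : SimpleGraph V}
    (hH : Bridgeless H) (r : V) :
    ∃ M : V → V → Prop, (∀ a b, M a b → M b a) ∧ (∀ a b, M a b → H.Adj a b) ∧
      (∀ u, #(nbrs H u) = 3 → ∃! v, M u v) ∧
      (∀ t, #(nbrs H t) = 2 → (∀ v, H.Adj t v → M t v) ∨ ∀ v, ¬ M t v) ∧
      (#(nbrs H r) = 2 → ∀ v, ¬ M r v) := by
  let Y := {p : V × V // (#(nbrs H p.1) = 3 ∧ p.2 = p.1) ∨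
    (#(nbrs H p.1) = 2 ∧ p.1 ≠ r ∧ H.Adj p.1 p.2)}
  let out : Y → Finset V := fun y => if #(nbrs H y.1.1) = 3 then nbrs H y.1.1 else {y.1.2}
  have hout : ∀ y : Y, ∀ b ∈ out y, H.Adj y.1.1 b := by
    rintro ⟨⟨a, a'⟩, h⟩ b hb
    rcases id h with ⟨h, -⟩ | ⟨h, -, h'⟩
    · simpa [out, h, mem_nbrs] using hb
    · have : b = a' := by simpa [out, h] using hb
      subst this
      exact h'
  have hpt : ∀ a b, H.Adj b a → ¬ (b = r ∧ #(nbrs H r) = 2) →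
      ∃! z : Y, z.1.1 = b ∧ a ∈ out z := by
    intro a b hba hb
    rcases hH.card_eq hba with h | h
    · refine ⟨⟨(b, a), Or.inr ⟨h, fun h' => hb ⟨h', h' ▸ h⟩, hba⟩⟩, ⟨rfl, by simp [out, h]⟩, ?_⟩
      rintro ⟨⟨c, c'⟩, hc⟩ ⟨rfl, h2⟩
      have : a = c' := by simpa [out, h] using h2
      subst this
      rfl
    · refine ⟨⟨(b, b), Or.inl ⟨h, rfl⟩⟩, ⟨rfl, by simpa [out, h, mem_nbrs] using hba⟩, ?_⟩
      rintro ⟨⟨c, c'⟩, hc⟩ ⟨rfl, h2⟩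
      rcases id hc with ⟨-, h'⟩ | ⟨h', -⟩
      · exact Subtype.ext (Prod.ext rfl h')
      · simp only at h h'
        omega
  have hroot : ∀ z : Y, ¬ (z.1.1 = r ∧ #(nbrs H r) = 2) := by
    rintro ⟨⟨c, c'⟩, hc⟩ h12
    obtain ⟨h1, h2⟩ : c = r ∧ #(nbrs H r) = 2 := h12
    rcases hc with ⟨h, -⟩ | ⟨-, h, -⟩
    · simp only at h
      rw [h1] at h
      omega
    · exact h h1
  have hcard_pt : ∀ a b, H.Adj b a →
      #{z : Y | z.1.1 = b ∧ a ∈ out z} + (if b = r ∧ #(nbrs H r) = 2 then 1 else 0) = 1 := by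
    intro a b hba
    by_cases hb : b = r ∧ #(nbrs H r) = 2
    · rw [if_pos hb, Nat.add_eq_right, card_eq_zero, filter_eq_empty_iff]
      rintro z - ⟨h, -⟩
      exact hroot z ⟨h.trans hb.1, hb.2⟩
    · rw [if_neg hb, add_zero, card_eq_one]
      obtain ⟨z, hz, hz'⟩ := hpt a b hba hb
      refine ⟨z, ?_⟩
      ext z'
      simp only [mem_filter, mem_univ, true_and, mem_singleton]
      exact ⟨hz' z', by rintro rfl; exact hz⟩
  let twin : Y → Y → ℕ := fun y z => if y.1.1 = z.1.1 ∧ y ≠ z then 2 else 0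
  let link : Y → Y → ℕ := fun y z => ∑ b ∈ out y, if z.1.1 = b ∧ y.1.1 ∈ out z then 1 else 0
  have hlink : ∀ y z, link y z = if z.1.1 ∈ out y ∧ y.1.1 ∈ out z then 1 else 0 := by
    intro y z
    by_cases h : y.1.1 ∈ out z
    · simp only [link, h, and_true, sum_ite_eq]
    · simp [link, h]
  let w : Y → Y → ℕ := fun y z => twin y z + link y z
  let e : Y → ℕ := fun y => ∑ b ∈ out y, if b = r ∧ #(nbrs H r) = 2 then 1 else 0
  have hrow : ∀ (S : Finset Y) (y : Y), ∑ z ∈ S, w y z + e y = ∑ z ∈ S, twin y z +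
      ∑ b ∈ out y, (#{z ∈ S | z.1.1 = b ∧ y.1.1 ∈ out z} +
        if b = r ∧ #(nbrs H r) = 2 then 1 else 0) := by
    intro S y
    simp only [w, e, link, sum_add_distrib, add_assoc]
    rw [sum_comm (s := S)]
    simp only [card_filter]
  have hfib3 : ∀ y z : Y, #(nbrs H y.1.1) = 3 → y.1.1 = z.1.1 → y = z := by
    rintro ⟨⟨a, a'⟩, h⟩ ⟨⟨b, b'⟩, h'⟩ h3 hab
    simp only at h h' h3 hab
    subst hab
    rcases h with ⟨-, rfl⟩ | ⟨h, -⟩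
    · rcases h' with ⟨-, rfl⟩ | ⟨h', -⟩
      · rfl
      · omega
    · omega
  have hdeg : ∀ y : Y, #(nbrs H y.1.1) = 3 ∨ #(nbrs H y.1.1) = 2 := by
    rintro ⟨⟨a, a'⟩, ⟨h, -⟩ | ⟨h, -⟩⟩
    · exact Or.inl h
    · exact Or.inr h
  have hother : ∀ y : Y, #(nbrs H y.1.1) = 2 → ∃ y' : Y, y' ≠ y ∧ y'.1.1 = y.1.1 ∧
      ∀ z : Y, z.1.1 = y.1.1 → z = y ∨ z = y' := by
    rintro ⟨⟨a, a'⟩, h⟩ h2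
    simp only at h2
    rcases h with ⟨h, -⟩ | ⟨-, hr, had⟩
    · simp only at h
      omega
    simp only at had hr
    obtain ⟨p, q, hpq, hpq'⟩ := card_eq_two.1 h2
    have hmem : ∀ v, H.Adj a v ↔ v = p ∨ v = q := by
      intro v
      rw [← mem_nbrs, hpq']
      simp
    obtain ⟨c, hc, hca, hall⟩ : ∃ c, H.Adj a c ∧ c ≠ a' ∧ ∀ v, H.Adj a v → v = a' ∨ v = c := by
      rcases (hmem a').1 had with rfl | rfl
      · exact ⟨q, (hmem q).2 (Or.inr rfl), hpq.symm, fun v hv => (hmem v).1 hv⟩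
      · exact ⟨p, (hmem p).2 (Or.inl rfl), hpq, fun v hv => ((hmem v).1 hv).symm⟩
    refine ⟨⟨(a, c), Or.inr ⟨h2, hr, hc⟩⟩, fun h => hca (congrArg (fun y : Y => y.1.2) h), rfl, ?_⟩
    rintro ⟨⟨b, b'⟩, hb⟩ hba
    simp only at hba
    subst hba
    rcases hb with ⟨h, -⟩ | ⟨-, -, hb⟩
    · simp only at h
      omega
    rcases hall b' hb with rfl | rfl
    · exact Or.inl rfl
    · exact Or.inr rfl
  have hws : ∀ x y, w x y = w y x := by
    intro x y
    simp only [w, hlink, twin]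
    exact congrArg₂ (· + ·) (if_congr (and_congr eq_comm ne_comm) rfl rfl)
      (if_congr and_comm rfl rfl)
  have hwd : ∀ x, w x x = 0 := by
    intro x
    have : x.1.1 ∉ out x := fun h => (hout x _ h).ne rfl
    simp [w, hlink, twin, this]
  have hsum : ∀ y, ∑ z, w y z + e y = 3 := by
    intro y
    have h1 : ∑ b ∈ out y, (#{z : Y | z.1.1 = b ∧ y.1.1 ∈ out z} +
        if b = r ∧ #(nbrs H r) = 2 then 1 else 0) = #(out y) := by
      rw [card_eq_sum_ones (out y)]
      exact sum_congr rfl fun b hb => hcard_pt _ _ (hout y b hb).symm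
    rw [hrow, h1]
    rcases hdeg y with h | h
    · have : ∀ z, twin y z = 0 := by
        intro z
        simp only [twin, ite_eq_right_iff]
        rintro ⟨h3, h4⟩
        exact absurd (hfib3 y z h h3) h4
      simp [this, out, h]
    · obtain ⟨y', hy', hy1, hy2⟩ := hother y h
      have : ∑ z, twin y z = twin y y' := by
        apply sum_eq_single_of_mem y' (mem_univ _)
        intro z _ hz
        simp only [twin, ite_eq_right_iff]
        rintro ⟨h3, h4⟩
        rcases hy2 z h3.symm with h5 | h5
        · exact absurd h5.symm h4
        · exact absurd h5 hz
      rw [this]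
      simp [twin, out, h, hy1, hy'.symm]
  have hesum : ∑ y, e y = 0 ∨ ∑ y, e y = 2 := by
    by_cases h : #(nbrs H r) = 2
    · right
      have h1 : ∀ y, e y = if r ∈ out y then 1 else 0 := by
        intro y
        simp [e, h]
      simp only [h1]
      rw [← card_filter]
      have h2 : Set.MapsTo (fun y : Y => y.1.1) (({y : Y | r ∈ out y} : Finset Y) : Set Y)
          (nbrs H r : Set V) := by
        intro y hy
        simp only [coe_filter, mem_univ, true_and, Set.mem_ofPred_eq] at hy
        simpa [mem_nbrs] using (hout y r hy).symm
      rw [card_eq_sum_card_fiberwise h2]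
      refine Eq.trans ?_ h
      rw [card_eq_sum_ones (nbrs H r)]
      refine sum_congr rfl fun b hb => ?_
      have hb' : H.Adj b r := (mem_nbrs.1 hb).symm
      have h3 := hcard_pt r b hb'
      rw [if_neg (fun h' => hb'.ne h'.1), add_zero] at h3
      rw [← h3, filter_filter]
      congr 1
      ext z
      simp [and_comm]
    · left
      simp [e, h]
  have hcut : ∀ K : Finset Y, ∑ y ∈ K, (∑ z ∈ Kᶜ, w y z + e y) ≠ 1 := by
    intro K hK
    have hclosed : ∀ y ∈ K, ∀ z, y.1.1 = z.1.1 → z ∈ K := by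
      intro y hy z hyz
      by_contra hz
      have h1 : ∑ z ∈ Kᶜ, w y z + e y ≤ 1 := by
        rw [← hK]
        exact single_le_sum (f := fun y => ∑ z ∈ Kᶜ, w y z + e y) (fun _ _ => Nat.zero_le _) hy
      have h2 : w y z ≤ ∑ z ∈ Kᶜ, w y z :=
        single_le_sum (f := fun z => w y z) (fun _ _ => Nat.zero_le _) (mem_compl.2 hz)
      have h3 : 2 ≤ w y z := by
        have : y ≠ z := by rintro rfl; exact hz hy
        simp [w, twin, hyz, this]
      omega
    let X : Finset V := K.image fun y => y.1.1
    have hX : ∀ y : Y, y.1.1 ∈ X ↔ y ∈ K := by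
      intro y
      refine ⟨fun h => ?_, fun h => mem_image_of_mem _ h⟩
      obtain ⟨z, hz, hzy⟩ := mem_image.1 h
      exact hclosed z hz y hzy
    apply hH.cut_ne X
    rw [← hK]
    have hterm : ∀ y ∈ K, ∑ z ∈ Kᶜ, w y z + e y = #(out y \ X) := by
      intro y hy
      rw [hrow]
      have h0 : ∑ z ∈ Kᶜ, twin y z = 0 := by
        apply sum_eq_zero
        intro z hz
        simp only [twin, ite_eq_right_iff]
        rintro ⟨h, -⟩
        exact absurd (hclosed y hy z h) (mem_compl.1 hz)
      rw [h0, zero_add, ← filter_notMem_eq_sdiff, card_filter]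
      refine sum_congr rfl fun b hb => ?_
      have h1 := hcard_pt y.1.1 b (hout y b hb).symm
      by_cases hbX : b ∈ X
      · obtain ⟨z, hz, rfl⟩ := mem_image.1 hbX
        rw [if_neg (hroot z)]
        simp only [hbX, not_true_eq_false, if_false, add_zero, card_eq_zero, filter_eq_empty_iff]
        rintro z' hz' ⟨h, -⟩
        exact mem_compl.1 hz' (hclosed z hz z' h.symm)
      · rw [if_pos hbX, ← h1]
        congr 2
        ext z
        simp only [mem_filter, mem_compl, mem_univ, true_and, and_iff_right_iff_imp]
        rintro ⟨rfl, -⟩ hz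
        exact hbX ((hX z).2 hz)
    rw [sum_congr rfl hterm]
    have hmaps : ∀ y ∈ K, y.1.1 ∈ X := fun y hy => (hX y).2 hy
    rw [← sum_fiberwise_of_maps_to hmaps]
    refine sum_congr rfl fun a ha => ?_
    obtain ⟨y, hy, rfl⟩ := mem_image.1 ha
    rcases hdeg y with h | h
    · have : ({z ∈ K | z.1.1 = y.1.1} : Finset Y) = {y} := by
        ext z
        simp only [mem_filter, mem_singleton]
        exact ⟨fun h' => (hfib3 y z h h'.2.symm).symm, by rintro rfl; exact ⟨hy, rfl⟩⟩
      rw [this, sum_singleton]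
      simp [out, h]
    · obtain ⟨y', hy', hy1, hy2⟩ := hother y h
      have : ({z ∈ K | z.1.1 = y.1.1} : Finset Y) = {y, y'} := by
        ext z
        simp only [mem_filter, mem_singleton, mem_insert]
        refine ⟨fun h' => hy2 z h'.2, ?_⟩
        rintro (rfl | rfl)
        · exact ⟨hy, rfl⟩
        · exact ⟨hclosed y hy _ hy1.symm, hy1⟩
      rw [this, sum_pair hy'.symm]
      have ho : out y = {y.1.2} := by simp [out, h]
      have ho' : out y' = {y'.1.2} := by simp [out, hy1, h]
      have hne : y.1.2 ≠ y'.1.2 := by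
        intro h'
        exact hy' (Subtype.ext (Prod.ext hy1 h'.symm))
      have hnb : nbrs H y.1.1 = {y.1.2, y'.1.2} := by
        symm
        apply eq_of_subset_of_card_le
        · intro v hv
          rw [mem_nbrs]
          rcases mem_insert.1 hv with rfl | hv
          · exact hout y _ (by simp [ho])
          · rw [mem_singleton.1 hv, ← hy1]
            exact hout y' _ (by simp [ho'])
        · rw [h, card_pair hne]
      rw [hnb, ho, ho', ← card_union_of_disjoint, ← union_sdiff_distrib]
      · rfl
      · apply disjoint_of_subset_left sdiff_subset
        apply disjoint_of_subset_right sdiff_subset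
        simpa using hne
  obtain ⟨μ, hμ, hμw⟩ := exists_matching_of_weights w e hws hwd hsum hesum fun K => by convert hcut K
  have hstep : ∀ y, (μ y).1.1 ≠ y.1.1 → (μ y).1.1 ∈ out y := by
    intro y hy
    have := hμw y
    simp only [w, hlink, twin, hy.symm, false_and, if_false, zero_add, ne_eq, ite_eq_right_iff,
      one_ne_zero, imp_false, not_not] at this
    exact this.1
  refine ⟨fun a b => a ≠ b ∧ ∃ y, y.1.1 = a ∧ (μ y).1.1 = b, ?_, ?_, ?_, ?_, ?_⟩
  · rintro _ _ ⟨hne, y, rfl, rfl⟩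
    exact ⟨hne.symm, μ y, rfl, by rw [hμ]⟩
  · rintro _ _ ⟨hne, y, rfl, rfl⟩
    exact hout y _ (hstep y hne.symm)
  · intro u hu
    let y : Y := ⟨(u, u), Or.inl ⟨hu, rfl⟩⟩
    have hne : u ≠ (μ y).1.1 := by
      intro h
      have := hfib3 y (μ y) hu h
      have h2 := hμw y
      rw [← this, hwd] at h2
      exact h2 rfl
    refine ⟨(μ y).1.1, ⟨hne, y, rfl, rfl⟩, ?_⟩
    rintro _ ⟨-, z, hz, rfl⟩
    rw [hfib3 y z hu hz.symm]
  · intro t ht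
    by_cases hex : ∃ v, t ≠ v ∧ ∃ y : Y, y.1.1 = t ∧ (μ y).1.1 = v
    · left
      obtain ⟨_, hne, y, rfl, rfl⟩ := hex
      obtain ⟨y', hy', hy1, hy2⟩ := hother y ht
      have hboth : ∀ z : Y, z.1.1 = y.1.1 → (μ z).1.1 ≠ y.1.1 := by
        intro z hz h
        rcases hy2 z hz with rfl | rfl
        · exact hne h.symm
        · rcases hy2 _ h with h' | h'
          · apply hne
            rw [← h', hμ, hy1, h']
          · have := hμw z
            rw [h', hwd] at this
            exact this rfl
      intro v hv
      have hr : y.1.1 ≠ r := fun h => hroot y ⟨h, h ▸ ht⟩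
      let z : Y := ⟨(y.1.1, v), Or.inr ⟨ht, hr, hv⟩⟩
      have hz := hboth z rfl
      have h1 := hstep z hz
      have h2 : (μ z).1.1 = v := by simpa [out, z, ht] using h1
      exact ⟨hv.ne, z, rfl, h2⟩
    · right
      rintro v ⟨h1, h2⟩
      exact hex ⟨v, h1, h2⟩
  · rintro hr v ⟨-, y, hy, -⟩
    exact hroot y ⟨hy, hr⟩

/-- A graph all of whose degrees are zero or two can be oriented so that it becomes the graph of
a permutation. -/
lemma exists_perm_of_two_regular {V : Type*} [Fintype V] (Q : V → V → Prop)
    (hs : ∀ a b, Q a b → Q b a) (hi : ∀ a, ¬ Q a a)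
    (hd : ∀ v w, Q v w → #{w | Q v w} = 2) :
    ∃ π : Equiv.Perm V, (∀ v, (∀ w, ¬ Q v w) → π v = v) ∧
      ∀ v, (∃ w, Q v w) → π v ≠ π.symm v ∧ ∀ w, Q v w ↔ w = π v ∨ w = π.symm v := by
  have htwo : ∀ v, (∃ w, Q v w) → ∃ p q, p ≠ q ∧ ∀ w, Q v w ↔ w = p ∨ w = q := by
    rintro v ⟨w, hw⟩
    obtain ⟨p, q, hpq, h⟩ := card_eq_two.1 (hd v w hw)
    refine ⟨p, q, hpq, fun w => ?_⟩
    simpa using Finset.ext_iff.1 h w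
  obtain ⟨s, hs₁, hs₂⟩ := exists_sign_of_matchings (X := V × V)
    (fun x y => Q x.1 x.2 ∧ y.1 = x.2 ∧ y.2 = x.1)
    (fun x y => Q x.1 x.2 ∧ Q y.1 y.2 ∧ y.1 = x.1 ∧ y.2 ≠ x.2)
    (by
      rintro ⟨a, b⟩ ⟨c, d⟩ ⟨h, h1, h2⟩
      simp only at h h1 h2
      subst h1 h2
      exact ⟨hs _ _ h, rfl, rfl⟩)
    (by
      rintro ⟨a, b⟩ ⟨c, d⟩ ⟨h, h1, h2, h3⟩
      exact ⟨h1, h, h2.symm, h3.symm⟩)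
    (by
      rintro ⟨a, b⟩ ⟨h, h1, h2⟩
      simp only at h h1 h2
      exact hi a (by rwa [← h1] at h))
    (by
      rintro ⟨a, b⟩ ⟨-, -, -, h⟩
      exact h rfl)
    (by
      rintro ⟨a, b⟩ ⟨c, d⟩ ⟨c', d'⟩ ⟨-, h1, h2⟩ ⟨-, h3, h4⟩
      exact Prod.ext (h1.trans h3.symm) (h2.trans h4.symm))
    (by
      rintro ⟨a, b⟩ ⟨c, d⟩ ⟨c', d'⟩ ⟨h, h1, h2, h3⟩ ⟨-, h5, h6, h7⟩
      simp only at h h1 h2 h3 h5 h6 h7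
      subst h2 h6
      obtain ⟨p, q, hpq, hQ⟩ := htwo _ ⟨b, h⟩
      rw [hQ] at h h1 h5
      grind)
  have hout : ∀ v, (∃ w, Q v w) → ∃ p q, p ≠ q ∧ (∀ w, Q v w ↔ w = p ∨ w = q) ∧
      s (v, p) = true ∧ s (v, q) = false := by
    intro v hv
    obtain ⟨p, q, hpq, hQ⟩ := htwo v hv
    have h1 : s (v, p) ≠ s (v, q) :=
      hs₂ (v, p) (v, q) ⟨(hQ p).2 (Or.inl rfl), (hQ q).2 (Or.inr rfl), rfl, hpq.symm⟩
    cases hp : s (v, p)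
    · refine ⟨q, p, hpq.symm, fun w => (hQ w).trans or_comm, ?_, hp⟩
      simpa [hp] using h1
    · refine ⟨p, q, hpq, hQ, hp, ?_⟩
      simpa [hp] using h1
  have hrev : ∀ v w, Q v w → s (v, w) ≠ s (w, v) := fun v w h => hs₁ (v, w) (w, v) ⟨h, rfl, rfl⟩
  choose p q hpq hQ hp hq using hout
  let g : V → V := fun v => if h : ∃ w, Q v w then p v h else v
  let g' : V → V := fun v => if h : ∃ w, Q v w then q v h else v
  have hg : ∀ v w, Q v w → s (v, w) = true → g v = w := by
    intro v w hw hs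
    have hex : ∃ w, Q v w := ⟨w, hw⟩
    simp only [g, dif_pos hex]
    rcases (hQ v hex w).1 hw with h | h
    · exact h.symm
    · have := hq v hex
      rw [← h, hs] at this
      cases this
  have hg' : ∀ v w, Q v w → s (v, w) = false → g' v = w := by
    intro v w hw hs
    have hex : ∃ w, Q v w := ⟨w, hw⟩
    simp only [g', dif_pos hex]
    rcases (hQ v hex w).1 hw with h | h
    · have := hp v hex
      rw [← h, hs] at this
      cases this
    · exact h.symm
  refine ⟨⟨g, g', fun v => ?_, fun v => ?_⟩, fun v hv => ?_, fun v hv => ?_⟩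
  · by_cases hv : ∃ w, Q v w
    · have h1 := (hQ v hv _).2 (Or.inl rfl)
      have h2 := hrev _ _ h1
      rw [hp v hv] at h2
      rw [hg v _ h1 (hp v hv)]
      exact hg' _ _ (hs _ _ h1) (by simpa using h2.symm)
    · simp [g, g', hv]
  · by_cases hv : ∃ w, Q v w
    · have h1 := (hQ v hv _).2 (Or.inr rfl)
      have h2 := hrev _ _ h1
      rw [hq v hv] at h2
      rw [hg' v _ h1 (hq v hv)]
      exact hg _ _ (hs _ _ h1) (by simpa using h2.symm)
    · simp [g, g', hv]
  · simp [g, hv]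
  · simp only [Equiv.coe_fn_mk, Equiv.coe_fn_symm_mk, g, g', dif_pos hv]
    exact ⟨hpq v hv, hQ v hv⟩

/-- A decomposition of a graph with degrees zero, two and three into the cycles of a permutation
`π` and a set `M` of further edges, such that the vertices in `Z` are on at most two edges of `M`
and on no cycle, while all other vertices on an edge of `M` are on just one and also on a cycle. -/
structure CycleDecomposition (V : Type*) where
  M : V → V → Prop
  π : Equiv.Perm V
  Z : V → Prop
  symm : ∀ a b, M a b → M b a
  irrefl : ∀ a, ¬ M a a
  eq_or_eq : ∀ z a b c, Z z → M z a → M z b → a ≠ b → M z c → c = a ∨ c = b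
  fixed : ∀ z, Z z → π z = z
  unique : ∀ v a b, ¬ Z v → M v a → M v b → a = b
  moved : ∀ v w, ¬ Z v → M v w → π v ≠ v
  apply_ne : ∀ v, π v ≠ v → π v ≠ π.symm v
  not_apply : ∀ v w, M v w → π v ≠ w

namespace CycleDecomposition

variable {V : Type*} (D : CycleDecomposition V)

/-- Vertices in `Z` without neighbours in `Z`. -/
def Isolated (z : V) : Prop := D.Z z ∧ ∀ a, D.M z a → ¬ D.Z a

lemma exists_sign (l : V → Fin 3) (j : Fin 3) (P : V → Prop)
    (hl : ∀ v, D.π v ≠ v → l v = j → l (D.π v) ≠ j) :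
    ∃ (s : V → Bool) (t : V → V → Bool),
      (∀ a b, D.M a b → ¬ D.Z a → t a b = s a) ∧
      (∀ a b, D.M a b → t a b ≠ t b a) ∧
      (∀ v, D.π v ≠ v → l v = j → s v ≠ s (D.π v)) ∧
      ∀ z a b, D.Z z → P z → D.M z a → D.M z b → a ≠ b → t z a ≠ t z b := by
  let pt : V → V → V × V := fun a b => if D.Z a then (a, b) else (a, a)
  have hpt : ∀ a b, (pt a b).1 = a := by
    intro a b
    by_cases h : D.Z a <;> simp [pt, h]
  have hinj : ∀ a b c d, D.M a b → D.M c d → pt a b = pt c d → a = c ∧ b = d := by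
    intro a b c d hab hcd h
    have h1 : a = c := by rw [← hpt a b, h, hpt]
    subst h1
    refine ⟨rfl, ?_⟩
    by_cases hZ : D.Z a
    · simpa [pt, hZ] using h
    · exact D.unique a b d hZ hab hcd
  obtain ⟨f, hf₁, hf₂⟩ := exists_sign_of_matchings (X := V × V)
    (fun x y => ∃ a b, D.M a b ∧ x = pt a b ∧ y = pt b a)
    (fun x y => (∃ v, D.π v ≠ v ∧ l v = j ∧
        ((x = (v, v) ∧ y = (D.π v, D.π v)) ∨ (y = (v, v) ∧ x = (D.π v, D.π v)))) ∨
      ∃ z a b, D.Z z ∧ P z ∧ D.M z a ∧ D.M z b ∧ a ≠ b ∧ x = (z, a) ∧ y = (z, b))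
    (by
      rintro x y ⟨a, b, h, rfl, rfl⟩
      exact ⟨b, a, D.symm _ _ h, rfl, rfl⟩)
    (by
      rintro x y (⟨v, h1, h2, h3⟩ | ⟨z, a, b, h1, h2, h3, h4, h5, rfl, rfl⟩)
      · exact Or.inl ⟨v, h1, h2, h3.symm⟩
      · exact Or.inr ⟨z, b, a, h1, h2, h4, h3, h5.symm, rfl, rfl⟩)
    (by
      rintro x ⟨a, b, h, rfl, h'⟩
      have := (hinj _ _ _ _ h (D.symm _ _ h) h').1
      subst this
      exact D.irrefl _ h)
    (by
      rintro x (⟨v, h1, h2, ⟨rfl, h3⟩ | ⟨rfl, h3⟩⟩ | ⟨z, a, b, h1, h2, h3, h4, h5, rfl, h6⟩)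
      · exact h1 (congrArg Prod.fst h3).symm
      · exact h1 (congrArg Prod.fst h3).symm
      · exact h5 (congrArg Prod.snd h6))
    (by
      rintro x y y' ⟨a, b, h, rfl, rfl⟩ ⟨a', b', h', h1, rfl⟩
      obtain ⟨rfl, rfl⟩ := hinj _ _ _ _ h h' h1
      rfl)
    (by
      rintro ⟨x, x'⟩ ⟨y, y'⟩ ⟨w, w'⟩
        (⟨v, h1, h2, ⟨h3, h4⟩ | ⟨h3, h4⟩⟩ | ⟨z, a, b, h1, h2, h3, h4, h5, h6, h7⟩)
        (⟨v', k1, k2, ⟨k3, k4⟩ | ⟨k3, k4⟩⟩ | ⟨z', a', b', k1, k2, k3, k4, k5, k6, k7⟩) <;>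
      simp only [Prod.mk.injEq] at *
      · grind
      · grind
      · have := D.irrefl x
        grind
      · grind
      · have := D.π.injective (a₁ := v) (a₂ := v')
        grind
      · have := D.irrefl x
        grind
      · have := D.irrefl x
        grind
      · have := D.irrefl x
        grind
      · have := D.eq_or_eq z a b b'
        grind)
  refine ⟨fun v => f (v, v), fun a b => f (pt a b), ?_, ?_, ?_, ?_⟩
  · intro a b _ hZ
    simp [pt, hZ]
  · intro a b h
    exact hf₁ _ _ ⟨a, b, h, rfl, rfl⟩
  · intro v h1 h2
    exact hf₂ _ _ (Or.inl ⟨v, h1, h2, Or.inl ⟨rfl, rfl⟩⟩)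
  · intro z a b hZ hP ha hb hab
    have h1 : ∀ c, pt z c = (z, c) := fun c => by simp [pt, hZ]
    simp only [h1]
    exact hf₂ _ _ (Or.inr ⟨z, a, b, hZ, hP, ha, hb, hab, rfl, rfl⟩)

lemma exists_edge_coloring [Fintype V] :
    ∃ κ : V → V → ℤ, (∀ a b, κ a b = κ b a) ∧ (∀ a b, 3 ≤ κ a b ∧ κ a b ≤ 5) ∧
      ∀ z a b, D.Z z → D.Z a → D.Z b → D.M z a → D.M z b → a ≠ b → κ z a ≠ κ z b := by
  obtain ⟨κ, hκ⟩ := exists_three_coloring (E := Sym2 V)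
    (fun e e' => ∃ z a b, D.Z z ∧ D.Z a ∧ D.Z b ∧ D.M z a ∧ D.M z b ∧ a ≠ b ∧
      e = s(z, a) ∧ e' = s(z, b))
    (by
      rintro e e' ⟨z, a, b, h1, h2, h3, h4, h5, h6, rfl, rfl⟩
      exact ⟨z, b, a, h1, h3, h2, h5, h4, h6.symm, rfl, rfl⟩)
    (by
      rintro e ⟨z, a, b, h1, h2, h3, h4, h5, h6, rfl, h7⟩
      simp only [Sym2.congr_right] at h7
      exact h6 h7)
    (by
      intro e
      induction e with
      | h p q =>
        have hone : ∀ z a, ∃ c, ∀ b, D.Z z → D.M z a → D.M z b → a ≠ b → b = c := by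
          intro z a
          by_cases h : ∃ c, D.Z z ∧ D.M z a ∧ D.M z c ∧ a ≠ c
          · obtain ⟨c, h1, h2, h3, h4⟩ := h
            refine ⟨c, fun b h5 h6 h7 h8 => ?_⟩
            rcases D.eq_or_eq z a c b h1 h2 h3 h4 h7 with h | h
            · exact absurd h.symm h8
            · exact h
          · exact ⟨a, fun b h1 h2 h3 h4 => absurd ⟨b, h1, h2, h3, h4⟩ h⟩
        obtain ⟨c, hc⟩ := hone p q
        obtain ⟨d, hd⟩ := hone q p
        refine (card_le_card (t := {s(p, c), s(q, d)}) ?_).trans card_le_two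
        intro e' he'
        simp only [mem_filter, mem_univ, true_and] at he'
        obtain ⟨z, a, b, h1, h2, h3, h4, h5, h6, h7, rfl⟩ := he'
        rcases Sym2.eq_iff.1 h7 with ⟨rfl, rfl⟩ | ⟨rfl, rfl⟩
        · rw [hc b h1 h4 h5 h6]
          simp
        · rw [hd b h1 h4 h5 h6]
          simp)
  refine ⟨fun a b => 3 + ((κ s(a, b)).val : ℤ), fun a b => by simp only [Sym2.eq_swap (a := a)], fun a b => ?_,
    fun z a b h1 h2 h3 h4 h5 h6 => ?_⟩
  · have := (κ s(a, b)).isLt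
    constructor <;> simp only <;> omega
  · have := hκ _ _ ⟨z, a, b, h1, h2, h3, h4, h5, h6, rfl, rfl⟩
    intro h
    apply this
    ext
    simpa using h

/-- Values along the cycles of a permutation that realise prescribed differences up to one. -/
lemma exists_cycle_values (C : V → Bool) (l : V → Fin 3) (k : V → ℤ) (hk : ∀ v, k v = 2 ∨ k v = 3)
    (h0 : ∀ v, D.π v ≠ v → l v = 0 → l (D.π v) = 1)
    (h1 : ∀ v, D.π v ≠ v → l v = 1 → C v ≠ C (D.π v))
    (h2 : ∀ v, D.π v ≠ v → l v = 2 → l (D.π v) = 0)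
    (hJ : ∀ v, D.π v ≠ v → l v = 0 → k v = 2 ∨ k (D.π v) = 2)
    (hE : ∀ v, D.π v ≠ v → l v = 2 → C v = C (D.π v) →
      k v = 2 ∧ k (D.π v) = 2 ∧ k (D.π (D.π v)) = 2) :
    ∃ x : V → ℤ, (∀ v, 2 ≤ x v ∧ x v ≤ 5) ∧ ∀ v, D.π v ≠ v →
      |(bif C v then k v else -k v) - (x (D.π.symm v) - x v)| ≤ 1 := by
  let m : V → ℤ := fun v => if C v ≠ C (D.π v) then 2 else if l v = 2 then 4 else
    if k (D.π v) = 3 then 4 else 3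
  refine ⟨fun v => bif C v then m v else 7 - m v, fun v => ?_, fun v hv => ?_⟩
  · simp only [m]
    cases C v <;> simp only [cond_true, cond_false] <;> split_ifs <;> omega
  · obtain ⟨u, rfl⟩ := D.π.surjective v
    have hu : D.π u ≠ u := fun h => hv (congrArg D.π h)
    simp only [Equiv.symm_apply_apply]
    have a0 := h0 u hu
    have a1 := h1 u hu
    have a2 := h2 u hu
    have a3 := hJ u hu
    have a4 := hE u hu
    have b0 := h0 _ hv
    have b1 := h1 _ hv
    have b2 := h2 _ hv
    have b3 := hJ _ hv
    have b4 := hE _ hv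
    have c1 := hk (D.π u)
    have c2 := hk (D.π (D.π u))
    simp only [m]
    generalize k u = k0 at *
    generalize k (D.π u) = k1 at *
    generalize k (D.π (D.π u)) = k2 at *
    generalize C u = e0 at *
    generalize C (D.π u) = e1 at *
    generalize C (D.π (D.π u)) = e2 at *
    generalize l u = l0 at *
    generalize l (D.π u) = l1 at *
    rw [abs_le]
    cases e0 <;> cases e1 <;> cases e2 <;> simp at * <;> fin_cases l0 <;> fin_cases l1 <;>
      simp at * <;> (try split_ifs) <;> omega

end CycleDecomposition

namespace CycleDecomposition

variable {V : Type*} (D : CycleDecomposition V)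

/-- Signs `C` and labels `l` on the vertices, together with weights `ψ` on the edges outside the
cycles, that allow the cycle values to be chosen independently of one another. -/
lemma exists_weights [Fintype V] (r : V) (m : ℤ) (hm : m = 2 ∨ m = 3) :
    ∃ (C : V → Bool) (l : V → Fin 3) (k : V → ℤ) (ψ : V → V → ℤ),
      (∀ v, k v = 2 ∨ k v = 3) ∧
      (∀ v, D.π v ≠ v → l v = 0 → l (D.π v) = 1) ∧
      (∀ v, D.π v ≠ v → l v = 1 → C v ≠ C (D.π v)) ∧
      (∀ v, D.π v ≠ v → l v = 2 → l (D.π v) = 0) ∧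
      (∀ v, D.π v ≠ v → l v = 0 → k v = 2 ∨ k (D.π v) = 2) ∧
      (∀ v, D.π v ≠ v → l v = 2 → C v = C (D.π v) →
        k v = 2 ∧ k (D.π v) = 2 ∧ k (D.π (D.π v)) = 2) ∧
      (∀ a b, D.M a b → ψ b a = -ψ a b) ∧
      (∀ a b, D.M a b → 2 ≤ |ψ a b| ∧ |ψ a b| ≤ 5) ∧
      (∀ a b, D.M a b → ¬ D.Z a → ψ a b = bif C a then k a else -k a) ∧
      (∀ z a b, D.Z z → D.M z a → D.M z b → a ≠ b →
        1 ≤ |ψ z a + ψ z b| ∧ |ψ z a + ψ z b| ≤ 4) ∧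
      (∀ v, (∀ w, ¬ D.M v w) → v ≠ r → k v = 2) ∧
      (D.π r ≠ r → (∀ w, ¬ D.M r w) → k r = m) := by
  let Free : V → Prop := fun v => D.π v ≠ v ∧ ((∀ w, ¬ D.M v w) ∨ ∃ z, D.M v z ∧ D.Isolated z)
  obtain ⟨l, hl⟩ := exists_arc_labels D.π Free
  have hl0 : ∀ v, D.π v ≠ v → l v = 0 → l (D.π v) = 1 := fun v hv => (hl v hv).1
  have hl1 : ∀ v, D.π v ≠ v → l v = 1 → l (D.π v) ≠ 1 := fun v hv => (hl v hv).2.1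
  have hl2 : ∀ v, D.π v ≠ v → l v = 2 → l (D.π v) = 0 := fun v hv h => ((hl v hv).2.2 h).1
  obtain ⟨s, t, hst, ht, hs, htz⟩ := D.exists_sign l 1 (fun z => ¬ D.Isolated z) hl1
  obtain ⟨σ, hσr, hσJ, hσz⟩ : ∃ σ : V → Bool, σ r = true ∧
      (∀ v, D.π v ≠ v → l v = 0 → σ v ≠ σ (D.π v)) ∧
      ∀ z a b, D.Isolated z → D.M z a → D.M z b → a ≠ b → σ a ≠ σ b := by
    obtain ⟨τ, t', h1, h2, h3, h4⟩ := D.exists_sign l 0 (fun _ => True)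
      (fun v hv h h' => by simp [hl0 v hv h] at h')
    refine ⟨fun v => τ v == τ r, by simp, fun v hv h => ?_, fun z a b hz ha hb hab => ?_⟩
    · have := h3 v hv h
      revert this
      beta_reduce
      cases τ v <;> cases τ (D.π v) <;> cases τ r <;> simp
    · have e1 := h1 a z (D.symm _ _ ha) (hz.2 a ha)
      have e2 := h1 b z (D.symm _ _ hb) (hz.2 b hb)
      have e3 := h2 z a ha
      have e4 := h2 z b hb
      have e5 := h4 z a b hz.1 trivial ha hb hab
      rw [e1] at e3
      rw [e2] at e4
      revert e3 e4 e5
      beta_reduce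
      cases τ a <;> cases τ b <;> cases τ r <;> cases t' z a <;> cases t' z b <;> simp
  obtain ⟨κ, hκs, hκb, hκ⟩ := D.exists_edge_coloring
  let C : V → Bool := fun v => if Free v ∧ l (D.π.symm v) = 2 then !(s (D.π.symm v)) else s v
  let Heavy : V → Prop := fun v => (v = r ∧ D.π r ≠ r ∧ (∀ w, ¬ D.M r w) ∧ m = 3) ∨
    (∃ z, D.M v z ∧ D.Isolated z ∧ (∃ b, D.M z b ∧ b ≠ v ∧ C b ≠ C v) ∧ σ v = true)
  let k : V → ℤ := fun v => if Heavy v then 3 else 2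
  let S : V → V → Bool := fun a b => if ¬ D.Z a then C a else if D.Isolated a then !(C b) else t a b
  let g : V → V → ℤ := fun a b => if D.Z a then (if D.Z b then κ a b else k b) else k a
  have hk : ∀ v, k v = 2 ∨ k v = 3 := by
    intro v
    by_cases h : Heavy v <;> simp [k, h]
  have hHeavyFree : ∀ v, Heavy v → Free v := by
    rintro v (⟨rfl, h1, h2, -⟩ | ⟨z, h1, h2, -⟩)
    · exact ⟨h1, Or.inl h2⟩
    · exact ⟨D.moved v z (h2.2 v (D.symm _ _ h1)) h1, Or.inr ⟨z, h1, h2⟩⟩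
  have hHeavyσ : ∀ v, Heavy v → σ v = true := by
    rintro v (⟨rfl, h1, h2, -⟩ | ⟨z, h1, h2, -, h3⟩)
    · exact hσr
    · exact h3
  have hlight : ∀ v, ¬ Free v → k v = 2 := fun v hv => if_neg fun h => hv (hHeavyFree v h)
  have hCnot : ∀ v, ¬ Free v → C v = s v := fun v hv => if_neg fun h => hv h.1
  have hnotFree : ∀ a b, D.M a b → ¬ D.Z a → ¬ D.Isolated b → ¬ Free a := by
    rintro a b hab hZ hb ⟨-, h | ⟨z, hz, hz'⟩⟩
    · exact h b hab
    · rw [D.unique a z b hZ hz hab] at hz'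
      exact hb hz'
  have hS : ∀ a b, D.M a b → S a b ≠ S b a := by
    intro a b hab
    have e1 := hnotFree a b hab
    have e2 := hnotFree b a (D.symm _ _ hab)
    have e3 := ht a b hab
    have e4 := hst a b hab
    have e5 := hst b a (D.symm _ _ hab)
    simp only [S]
    by_cases hZa : D.Z a <;> by_cases hZb : D.Z b
    · have hIa : ¬ D.Isolated a := fun h => h.2 b hab hZb
      have hIb : ¬ D.Isolated b := fun h => h.2 a (D.symm _ _ hab) hZa
      simpa [hZa, hZb, hIa, hIb] using e3
    · by_cases hIa : D.Isolated a
      · simp [hZa, hZb, hIa]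
      · rw [e5 hZb, ← hCnot b (e2 hZb hIa)] at e3
        simpa [hZa, hZb, hIa] using e3
    · by_cases hIb : D.Isolated b
      · simp [hZa, hZb, hIb]
      · rw [e4 hZa, ← hCnot a (e1 hZa hIb)] at e3
        simpa [hZa, hZb, hIb] using e3
    · rw [e4 hZa, e5 hZb, ← hCnot a (e1 hZa fun h => hZb h.1),
        ← hCnot b (e2 hZb fun h => hZa h.1)] at e3
      simpa [hZa, hZb] using e3
  have hg : ∀ a b, D.M a b → g a b = g b a := by
    intro a b hab
    simp only [g]
    by_cases hZa : D.Z a <;> by_cases hZb : D.Z b <;> simp only [hZa, hZb, if_true, if_false]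
    · exact hκs a b
    · have e1 := hnotFree a b hab hZa fun h => hZb h.1
      have e2 := hnotFree b a (D.symm _ _ hab) hZb fun h => hZa h.1
      rw [hlight a e1, hlight b e2]
  have hgb : ∀ a b, 2 ≤ g a b ∧ g a b ≤ 5 := by
    intro a b
    have e1 := hκb a b
    have e2 := hk a
    have e3 := hk b
    simp only [g]
    split_ifs <;> omega
  have hsucc : ∀ v, D.π v ≠ v → l v ≠ 0 → C v = s v := by
    intro v hv h
    refine if_neg fun h' => h ?_
    have e1 : D.π (D.π.symm v) ≠ D.π.symm v := by
      intro h2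
      rw [Equiv.apply_symm_apply] at h2
      apply hv
      conv_lhs => rw [h2]
      simp
    simpa using hl2 _ e1 h'.2
  refine ⟨C, l, k, fun a b => bif S a b then g a b else -g a b, hk, hl0, ?_, hl2, ?_, ?_, ?_, ?_,
    ?_, ?_, ?_, ?_⟩
  · intro v hv h
    rw [hsucc v hv (by simp [h])]
    have : C (D.π v) = s (D.π v) := if_neg fun h' => by simp [h] at h'
    rw [this]
    exact hs v hv h
  · intro v hv h
    by_contra! hne
    have e1 : Heavy v := by
      by_contra h'
      exact hne.1 (if_neg h')
    have e2 : Heavy (D.π v) := by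
      by_contra h'
      exact hne.2 (if_neg h')
    apply hσJ v hv h
    rw [hHeavyσ _ e1, hHeavyσ _ e2]
  · intro v hv h hC
    have e1 : ¬ Free (D.π v) := by
      intro h'
      rw [hsucc v hv (by simp [h])] at hC
      have : C (D.π v) = !(s v) := by simp [C, h', h]
      rw [this] at hC
      simp at hC
    have e2 := ((hl v hv).2.2 h).2.resolve_left e1
    refine ⟨hlight _ (e2 _ (Equiv.Perm.SameCycle.refl _ _)), hlight _ e1, hlight _ (e2 _ ?_)⟩
    simpa using Equiv.Perm.SameCycle.refl D.π v
  · intro a b hab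
    have e1 := hS a b hab
    have e2 := hg a b hab
    simp only [← e2]
    revert e1
    cases S a b <;> cases S b a <;> simp
  · intro a b hab
    have := hgb a b
    beta_reduce
    cases S a b <;> simp only [cond_true, cond_false, abs_neg] <;>
      rwa [abs_of_nonneg (by omega)]
  · intro a b hab hZ
    simp [S, g, hZ]
  · intro z a b hz ha hb hab
    by_cases hI : D.Isolated z
    · have hZa := hI.2 a ha
      have hZb := hI.2 b hb
      have hσ := hσz z a b hI ha hb hab
      have hheavy : ∀ a b, D.M z a → D.M z b → a ≠ b → (Heavy a ↔ C b ≠ C a ∧ σ a = true) := by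
        intro a b ha hb hab
        constructor
        · rintro (⟨rfl, -, h, -⟩ | ⟨z', h1, h2, ⟨b', h3, h4, h5⟩, h6⟩)
          · exact absurd (D.symm _ _ ha) (h z)
          · have := D.unique a z' z (hI.2 a ha) h1 (D.symm _ _ ha)
            subst this
            rcases D.eq_or_eq _ a b b' hz ha hb hab h3 with h | h
            · exact absurd h h4
            · subst h
              exact ⟨h5, h6⟩
        · rintro ⟨h1, h2⟩
          exact Or.inr ⟨z, D.symm _ _ ha, hI, ⟨b, hb, hab.symm, h1⟩, h2⟩
      have hHa := hheavy a b ha hb hab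
      have hHb := hheavy b a hb ha hab.symm
      simp only [S, g, hz, hZa, hZb, hI, k, hHa, hHb, not_true_eq_false, if_false, if_true]
      revert hσ
      cases C a <;> cases C b <;> cases σ a <;> cases σ b <;> simp
    · have e1 := htz z a b hz hI ha hb hab
      have hSa : ∀ c, S z c = t z c := by
        intro c
        simp [S, hz, hI]
      simp only [hSa]
      have hgZ : ∀ c, D.Z c → g z c = κ z c := fun c hc => by simp [g, hz, hc]
      have hgn : ∀ c, D.M z c → ¬ D.Z c → g z c = 2 := by
        intro c hc hZc
        have := hlight c (hnotFree c z (D.symm _ _ hc) hZc hI)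
        simp [g, hz, hZc, this]
      have hne : g z a ≠ g z b ∧ |g z a - g z b| ≤ 3 := by
        have e2 := hκb z a
        have e3 := hκb z b
        rw [abs_le]
        by_cases hZa : D.Z a <;> by_cases hZb : D.Z b
        · rw [hgZ a hZa, hgZ b hZb]
          exact ⟨hκ z a b hz hZa hZb ha hb hab, by omega, by omega⟩
        · rw [hgZ a hZa, hgn b hb hZb]
          omega
        · rw [hgn a ha hZa, hgZ b hZb]
          omega
        · refine absurd ⟨hz, fun c hc => ?_⟩ hI
          rcases D.eq_or_eq z a b c hz ha hb hab hc with rfl | rfl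
          · exact hZa
          · exact hZb
      obtain ⟨h1, h2⟩ := hne
      rw [abs_le] at h2
      cases h3 : t z a <;> cases h4 : t z b <;> simp only [cond_true, cond_false] <;>
        first
        | exact absurd (h3.trans h4.symm) e1
        | (rcases abs_cases (-g z a + g z b) with h | h <;> omega)
        | (rcases abs_cases (g z a + -g z b) with h | h <;> omega)
  · intro v hv hvr
    refine if_neg ?_
    rintro (⟨rfl, -⟩ | ⟨z, h, -⟩)
    · exact hvr rfl
    · exact hv z h
  · intro h1 h2
    rcases hm with rfl | rfl
    · refine if_neg ?_
      rintro (⟨-, -, -, h⟩ | ⟨z, h, -⟩)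
      · norm_num at h
      · exact h2 z h
    · exact if_pos (Or.inl ⟨rfl, h1, h2, rfl⟩)

lemma exists_flow [Fintype V] (r : V) (m : ℤ) (hm : m = 2 ∨ m = 3) :
    ∃ φ : V → V → ℤ, (∀ u v, φ v u = -φ u v) ∧
      (∀ u v, D.M u v → 2 ≤ |φ u v| ∧ |φ u v| ≤ 5) ∧
      (∀ v, D.π v ≠ v → 2 ≤ |φ v (D.π v)| ∧ |φ v (D.π v)| ≤ 5) ∧
      (∀ z a b, D.Z z → D.M z a → D.M z b → a ≠ b →
        1 ≤ |φ z a + φ z b| ∧ |φ z a + φ z b| ≤ 4) ∧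
      (∀ v w, D.π v ≠ v → D.M v w → |φ v (D.π v) + φ v (D.π.symm v) + φ v w| ≤ 1) ∧
      (∀ v, D.π v ≠ v → (∀ w, ¬ D.M v w) →
        1 ≤ |φ v (D.π v) + φ v (D.π.symm v)| ∧ |φ v (D.π v) + φ v (D.π.symm v)| ≤ 4) ∧
      (D.π r ≠ r → (∀ w, ¬ D.M r w) → m - 1 ≤ |φ r (D.π r) + φ r (D.π.symm r)| ∧
        |φ r (D.π r) + φ r (D.π.symm r)| ≤ m + 1) := by
  obtain ⟨C, l, k, ψ, hk, h0, h1, h2, hJ, hE, hψ, hψb, hψn, hψz, hk2, hkr⟩ :=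
    D.exists_weights r m hm
  obtain ⟨x, hx, hx'⟩ := D.exists_cycle_values C l k hk h0 h1 h2 hJ hE
  let φ : V → V → ℤ := fun u v => if D.M u v then ψ u v else
    if D.π u = v then (if D.π v = u then 0 else x u) else if D.π v = u then -x v else 0
  have hM : ∀ u v, D.M u v → φ u v = ψ u v := fun u v h => if_pos h
  have hnM : ∀ v, ¬ D.M v (D.π v) := fun v h => D.not_apply _ _ h rfl
  have hout : ∀ v, D.π v ≠ v → φ v (D.π v) = x v := by
    intro v hv
    have e : D.π (D.π v) ≠ v := by
      intro h
      apply D.apply_ne v hv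
      rw [Equiv.eq_symm_apply, h]
    simp [φ, hnM, e]
  have hanti : ∀ u v, φ v u = -φ u v := by
    intro u v
    by_cases h : D.M u v
    · rw [hM _ _ h, hM _ _ (D.symm _ _ h), hψ _ _ h]
    · have h' : ¬ D.M v u := fun h' => h (D.symm _ _ h')
      by_cases e1 : D.π u = v <;> by_cases e2 : D.π v = u <;> simp [φ, h, h', e1, e2]
  have hin : ∀ v, D.π v ≠ v → φ v (D.π.symm v) = -x (D.π.symm v) := by
    intro v hv
    obtain ⟨u, rfl⟩ := D.π.surjective v
    rw [Equiv.symm_apply_apply, hanti u, hout u fun h => hv (congrArg D.π h)]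
  refine ⟨φ, hanti, fun u v h => ?_, fun v hv => ?_, fun z a b hz ha hb hab => ?_,
    fun v w hv hw => ?_, fun v hv hw => ?_, fun hr hw => ?_⟩
  · rw [hM _ _ h]
    exact hψb _ _ h
  · have := hx v
    rwa [hout v hv, abs_of_nonneg (by omega)]
  · rw [hM _ _ ha, hM _ _ hb]
    exact hψz z a b hz ha hb hab
  · have hZ : ¬ D.Z v := fun h => hv (D.fixed v h)
    rw [hout v hv, hin v hv, hM _ _ hw, hψn v w hw hZ]
    convert hx' v hv using 2
    ring
  · have e1 := hx' v hv
    have e2 := hk v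
    rw [hout v hv, hin v hv]
    rw [abs_le] at e1
    rcases abs_cases (x v + -x (D.π.symm v)) with h | h <;> cases hC : C v <;>
      simp only [hC, cond_true, cond_false] at e1 <;> omega
  · have e1 := hx' r hr
    have e2 := hkr hr hw
    rw [hout r hr, hin r hr]
    rw [abs_le, e2] at e1
    rcases abs_cases (x r + -x (D.π.symm r)) with h | h <;> cases hC : C r <;>
      simp only [hC, cond_true, cond_false] at e1 <;> omega

end CycleDecomposition

/-- In a bridgeless graph with degrees at most three there is an integer flow with values of
modulus between two and five, almost conserved at the vertices of degree three and with a small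
nonzero excess at the vertices of degree two, which is prescribed more precisely at `r`. -/
lemma Bridgeless.exists_flow {V : Type*} [Fintype V] {H : SimpleGraph V} (hH : Bridgeless H)
    (r : V) (m : ℤ) (hm : m = 2 ∨ m = 3) :
    ∃ φ : V → V → ℤ, (∀ u v, φ v u = -φ u v) ∧
      (∀ u v, H.Adj u v → 2 ≤ |φ u v| ∧ |φ u v| ≤ 5) ∧
      (∀ u, #(nbrs H u) = 3 → |∑ v ∈ nbrs H u, φ u v| ≤ 1) ∧
      (∀ u, #(nbrs H u) = 2 → 1 ≤ |∑ v ∈ nbrs H u, φ u v| ∧ |∑ v ∈ nbrs H u, φ u v| ≤ 4) ∧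
      (#(nbrs H r) = 2 → m - 1 ≤ |∑ v ∈ nbrs H r, φ r v| ∧
        |∑ v ∈ nbrs H r, φ r v| ≤ m + 1) := by
  obtain ⟨M, hMs, hMH, hM3, hM2, hMr⟩ := hH.exists_matching r
  let Q : V → V → Prop := fun a b => H.Adj a b ∧ ¬ M a b
  have hQ3 : ∀ v w, #(nbrs H v) = 3 → M v w → #{w | Q v w} = 2 := by
    intro v w hv hw
    have : ({w | Q v w} : Finset V) = (nbrs H v).erase w := by
      ext x
      simp only [Q, mem_filter, mem_univ, true_and, mem_erase, mem_nbrs, and_comm]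
      refine and_congr_left fun _ => not_congr ⟨fun h => ?_, fun h => h ▸ hw⟩
      exact (hM3 v hv).unique h hw
    rw [this, card_erase_of_mem (mem_nbrs.2 (hMH _ _ hw)), hv]
  have hQ2 : ∀ v, #(nbrs H v) = 2 → (∀ w, ¬ M v w) → #{w | Q v w} = 2 := by
    intro v hv hw
    rw [← hv]
    congr 1
    ext x
    simp [Q, mem_nbrs, hw]
  obtain ⟨π, hπf, hπQ⟩ := exists_perm_of_two_regular Q
    (fun a b h => ⟨h.1.symm, fun h' => h.2 (hMs _ _ h')⟩) (fun a h => h.1.ne rfl) (by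
      intro v w hvw
      rcases hH.card_eq hvw.1 with h | h
      · rcases hM2 v h with h' | h'
        · exact absurd (h' w hvw.1) hvw.2
        · convert hQ2 v h h'
      · obtain ⟨x, hx, -⟩ := hM3 v h
        convert hQ3 v x h hx)
  have hactive : ∀ v, π v ≠ v → ∃ w, Q v w := by
    intro v hv
    by_contra! h
    exact hv (hπf v h)
  have hmoved : ∀ v w, Q v w → π v ≠ v := by
    intro v w h h'
    have := ((hπQ v ⟨w, h⟩).2 (π v)).2 (Or.inl rfl)
    rw [h'] at this
    exact this.1.ne rfl
  have hmoved3 : ∀ v, #(nbrs H v) = 3 → π v ≠ v := by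
    intro v hv
    obtain ⟨x, hx, -⟩ := hM3 v hv
    obtain ⟨w, hw⟩ : ({w | Q v w} : Finset V).Nonempty := by
      rw [← card_pos, hQ3 v x hv hx]
      norm_num
    exact hmoved v w (by simpa using hw)
  have htwo : ∀ v, #(nbrs H v) = 2 → ∃ p q, p ≠ q ∧ nbrs H v = {p, q} :=
    fun v hv => card_eq_two.1 hv
  have hdeg3 : ∀ v a, ¬ (#(nbrs H v) = 2 ∧ ∃ w, M v w) → M v a → #(nbrs H v) = 3 :=
    fun v a hZ ha => (hH.card_eq (hMH _ _ ha)).resolve_left fun h => hZ ⟨h, a, ha⟩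
  have hall : ∀ v, (#(nbrs H v) = 2 ∧ ∃ w, M v w) → ∀ a, H.Adj v a → M v a := by
    rintro v ⟨hv, w, hw⟩
    exact (hM2 v hv).resolve_right fun h => h w hw
  let D : CycleDecomposition V :=
    { M := M
      π := π
      Z := fun z => #(nbrs H z) = 2 ∧ ∃ w, M z w
      symm := hMs
      irrefl := fun a h => (hMH _ _ h).ne rfl
      eq_or_eq := by
        intro z a b c hz ha hb hab hc
        obtain ⟨p, q, hpq, h⟩ := htwo z hz.1
        have hmem : ∀ x, M z x → x = p ∨ x = q := by
          intro x hx
          have := mem_nbrs.2 (hMH _ _ hx)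
          simpa [h] using this
        have := hmem a ha
        have := hmem b hb
        have := hmem c hc
        grind
      fixed := fun z hz => hπf z fun w h => h.2 (hall z hz w h.1)
      unique := fun v a b hZ ha hb => (hM3 v (hdeg3 v a hZ ha)).unique ha hb
      moved := fun v w hZ hw => hmoved3 v (hdeg3 v w hZ hw)
      apply_ne := fun v hv => (hπQ v (hactive v hv)).1
      not_apply := by
        rintro v w hw rfl
        exact (((hπQ v (hactive v (hMH _ _ hw).ne')).2 _).2 (Or.inl rfl)).2 hw }
  obtain ⟨φ, hanti, hφM, hφπ, hφZ, hφ3, hφ2, hφr⟩ := D.exists_flow r m hm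
  have hsum2 : ∀ v, #(nbrs H v) = 2 → (∀ w, ¬ M v w) → π v ≠ v ∧
      ∑ w ∈ nbrs H v, φ v w = φ v (π v) + φ v (π.symm v) := by
    intro v hv hw
    obtain ⟨p, q, hpq, h⟩ := htwo v hv
    have hp : Q v p := ⟨by simp [← mem_nbrs, h], hw p⟩
    have e := hπQ v ⟨p, hp⟩
    have : nbrs H v = {π v, π.symm v} := by
      ext x
      simp [mem_nbrs, ← e.2, Q, hw]
    exact ⟨hmoved v p hp, by rw [this, sum_pair e.1]⟩
  have hsum3 : ∀ v w, #(nbrs H v) = 3 → M v w →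
      ∑ w ∈ nbrs H v, φ v w = φ v (π v) + φ v (π.symm v) + φ v w := by
    intro v w hv hw
    have e := hπQ v (hactive v (hmoved3 v hv))
    have h1 : ¬ Q v w := fun h => h.2 hw
    have h2 : w ∉ ({π v, π.symm v} : Finset V) := by
      simpa [e.2] using h1
    have : nbrs H v = insert w {π v, π.symm v} := by
      ext x
      simp only [mem_insert, mem_singleton, ← e.2, mem_nbrs, Q]
      constructor
      · intro hx
        by_cases hMx : M v x
        · exact Or.inl ((hM3 v hv).unique hMx hw)
        · exact Or.inr ⟨hx, hMx⟩
      · rintro (rfl | hx)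
        · exact hMH _ _ hw
        · exact hx.1
    rw [this, sum_insert h2, sum_pair e.1]
    ring
  refine ⟨φ, hanti, fun u v huv => ?_, fun u hu => ?_, fun u hu => ?_, fun hr => ?_⟩
  · by_cases hM : M u v
    · exact hφM u v hM
    · have e := hπQ u ⟨v, huv, hM⟩
      rcases (e.2 v).1 ⟨huv, hM⟩ with rfl | rfl
      · exact hφπ u (hmoved _ _ ⟨huv, hM⟩)
      · have h1 : π (π.symm u) ≠ π.symm u := by
          rw [Equiv.apply_symm_apply]
          exact huv.ne
        have := hφπ _ h1
        change 2 ≤ |φ _ (π (π.symm u))| ∧ |φ _ (π (π.symm u))| ≤ 5 at this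
        rw [Equiv.apply_symm_apply] at this
        rwa [hanti, abs_neg]
  · obtain ⟨w, hw, -⟩ := hM3 u hu
    rw [hsum3 u w hu hw]
    exact hφ3 u w (hmoved3 u hu) hw
  · by_cases hZ : ∃ w, M u w
    · obtain ⟨p, q, hpq, h⟩ := htwo u hu
      have hp : M u p := hall u ⟨hu, hZ⟩ p (by simp [← mem_nbrs, h])
      have hq : M u q := hall u ⟨hu, hZ⟩ q (by simp [← mem_nbrs, h])
      rw [h, sum_pair hpq]
      exact hφZ u p q ⟨hu, hZ⟩ hp hq hpq
    · push Not at hZ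
      obtain ⟨h1, h2⟩ := hsum2 u hu hZ
      rw [h2]
      exact hφ2 u h1 hZ
  · obtain ⟨h1, h2⟩ := hsum2 r hr (hMr hr)
    rw [h2]
    exact hφr h1 (hMr hr)

/-- A flow of a cubic graph around the vertices in `W`, in units of one half, where `B t p` is the
set of moduli allowed on an edge from `t ∈ W` to `p ∉ W`. -/
def FlowOn {V : Type*} [Fintype V] (G : SimpleGraph V) (W : Finset V) (B : V → V → ℤ → Prop)
    (φ : V → V → ℤ) : Prop :=
  ∀ u ∈ W, (∀ v, G.Adj u v → (2 ≤ |φ u v| ∧ |φ u v| ≤ 5) ∧ (v ∈ W → φ v u = -φ u v) ∧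
    (v ∉ W → B u v |φ u v|)) ∧ |∑ v ∈ nbrs G u, φ u v| ≤ 1

/-- An edge on which both two and one of three, four, five are allowed. -/
def Flexible (P : ℤ → Prop) : Prop := P 2 ∧ ∃ k, (3 ≤ k ∧ k ≤ 5) ∧ P k

/-- Flows on the two sides of a cut consisting of one edge can be combined. -/
lemma FlowOn.glue {V : Type*} [Fintype V] {G : SimpleGraph V} {X W : Finset V}
    {B B₁ B₂ : V → V → ℤ → Prop} {φ₁ φ₂ : V → V → ℤ} {x y : V} (hXW : X ⊆ W)
    (hx : x ∈ X) (hy : y ∈ W \ X) (hxy : G.Adj x y)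
    (hcut : ∀ u ∈ X, ∀ v ∈ W \ X, G.Adj u v → u = x ∧ v = y)
    (h₁ : FlowOn G X B₁ φ₁) (h₂ : FlowOn G (W \ X) B₂ φ₂)
    (hB₁ : ∀ u ∈ X, ∀ v ∉ W, B₁ u v = B u v)
    (hB₂ : ∀ u ∈ W \ X, ∀ v ∉ W, B₂ u v = B u v) (habs : |φ₁ x y| = |φ₂ y x|) :
    ∃ φ, FlowOn G W B φ := by
  obtain ⟨ε, hε, hεxy⟩ : ∃ ε : ℤ, |ε| = 1 ∧ φ₂ y x = -(ε * φ₁ x y) := by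
    rcases abs_eq_abs.1 habs with h | h
    · exact ⟨-1, by norm_num, by rw [h]; ring⟩
    · exact ⟨1, by norm_num, by rw [h]; ring⟩
  have habs1 : ∀ a : ℤ, |ε * a| = |a| := fun a => by rw [abs_mul, hε, one_mul]
  refine ⟨fun u v => if u ∈ X then ε * φ₁ u v else φ₂ u v, fun u hu => ?_⟩
  by_cases huX : u ∈ X
  · obtain ⟨h, hs⟩ := h₁ u huX
    simp only [if_pos huX]
    refine ⟨fun v huv => ⟨?_, fun hv => ?_, fun hv => ?_⟩, ?_⟩
    · rw [habs1]
      exact (h v huv).1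
    · by_cases hvX : v ∈ X
      · rw [if_pos hvX, (h v huv).2.1 hvX]
        ring
      · obtain ⟨rfl, rfl⟩ := hcut u huX v (mem_sdiff.2 ⟨hv, hvX⟩) huv
        rw [if_neg hvX, hεxy]
    · rw [habs1, ← hB₁ u huX v hv]
      exact (h v huv).2.2 fun h' => hv (hXW h')
    · rw [← mul_sum, habs1]
      exact hs
  · have huW : u ∈ W \ X := mem_sdiff.2 ⟨hu, huX⟩
    obtain ⟨h, hs⟩ := h₂ u huW
    simp only [if_neg huX]
    refine ⟨fun v huv => ⟨(h v huv).1, fun hv => ?_, fun hv => ?_⟩, hs⟩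
    · by_cases hvX : v ∈ X
      · obtain ⟨rfl, rfl⟩ := hcut v hvX u huW huv.symm
        rw [if_pos hvX, hεxy]
        ring
      · rw [if_neg hvX, (h v huv).2.1 (mem_sdiff.2 ⟨hv, hvX⟩)]
    · rw [← hB₂ u huW v hv]
      exact (h v huv).2.2 fun h' => hv (mem_sdiff.1 h').1

/-- The subgraph of the edges with both ends in `W`. -/
def within {V : Type*} (G : SimpleGraph V) (W : Finset V) : SimpleGraph V where
  Adj u v := G.Adj u v ∧ u ∈ W ∧ v ∈ W
  symm := ⟨fun _ _ h => ⟨h.1.symm, h.2.2, h.2.1⟩⟩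
  loopless := ⟨fun _ h => h.1.ne rfl⟩

lemma nbrs_within {V : Type*} [Fintype V] (G : SimpleGraph V) {W : Finset V} {u : V}
    (hu : u ∈ W) : nbrs (within G W) u = nbrs G u ∩ W := by
  ext v
  simp [mem_nbrs, within, hu]

/-- If the edges within `W` are not bridgeless, then some edge is a cut. -/
lemma exists_cut_edge {V : Type*} [Fintype V] {G : SimpleGraph V} (hG : ∀ v, #(nbrs G v) = 3)
    {W : Finset V} (h : ¬ Bridgeless (within G W)) :
    ∃ X ⊆ W, ∃ x ∈ X, ∃ y ∈ W \ X, G.Adj x y ∧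
      ∀ u ∈ X, ∀ v ∈ W \ X, G.Adj u v → u = x ∧ v = y := by
  by_contra! hcon
  refine h ⟨fun v => ?_, fun X hX => ?_⟩
  · rw [← hG v]
    apply card_le_card
    intro w hw
    exact mem_nbrs.2 (mem_nbrs.1 hw).1
  · obtain ⟨x, hx, hxne⟩ := exists_ne_zero_of_sum_ne_zero (hX.trans_ne one_ne_zero)
    rw [← add_sum_erase _ _ hx] at hX
    have hx1 : #(nbrs (within G W) x \ X) = 1 := by omega
    have hx0 : ∀ u ∈ X, u ≠ x → #(nbrs (within G W) u \ X) = 0 := fun u hu hux =>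
      sum_eq_zero_iff.1 (show ∑ u ∈ X.erase x, #(nbrs (within G W) u \ X) = 0 by omega) u
        (mem_erase.2 ⟨hux, hu⟩)
    obtain ⟨y, hy⟩ := card_eq_one.1 hx1
    have hmem : ∀ v, (G.Adj x v ∧ x ∈ W ∧ v ∈ W) ∧ v ∉ X ↔ v = y := by
      intro v
      rw [← mem_singleton, ← hy, mem_sdiff, mem_nbrs]
      rfl
    obtain ⟨⟨hxy, hxW, hyW⟩, hyX⟩ := (hmem y).2 rfl
    obtain ⟨u, hu, v, hv, huv, hne⟩ := hcon (X ∩ W) inter_subset_right x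
      (mem_inter.2 ⟨hx, hxW⟩) y (by simp [hyW, hyX]) hxy
    have hvW : v ∈ W := (mem_sdiff.1 hv).1
    have hvX : v ∉ X := fun h => (mem_sdiff.1 hv).2 (mem_inter.2 ⟨h, hvW⟩)
    obtain ⟨huX, huW⟩ := mem_inter.1 hu
    by_cases hux : u = x
    · subst hux
      exact hne rfl ((hmem v).1 ⟨⟨huv, huW, hvW⟩, hvX⟩)
    · have := hx0 u huX hux
      rw [card_eq_zero] at this
      have hv' : v ∈ nbrs (within G W) u \ X :=
        mem_sdiff.2 ⟨mem_nbrs.2 ⟨huv, huW, hvW⟩, hvX⟩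
      rw [this] at hv'
      simp at hv'

lemma exists_flowOn_of_bridgeless {V : Type*} [Fintype V] {G : SimpleGraph V}
    (hG : ∀ v, #(nbrs G v) = 3) {W : Finset V} (hW : Bridgeless (within G W))
    (B : V → V → ℤ → Prop) (t₀ p₀ : V)
    (hB : ∀ t ∈ W, ∀ p ∉ W, G.Adj t p → (t ≠ t₀ ∨ p ≠ p₀) → Flexible (B t p))
    (hroot : B t₀ p₀ 2 ∨ B t₀ p₀ 3) : ∃ φ, FlowOn G W B φ := by
  obtain ⟨m, hm, hBm⟩ : ∃ m : ℤ, (m = 2 ∨ m = 3) ∧ B t₀ p₀ m := by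
    rcases hroot with h | h
    · exact ⟨2, Or.inl rfl, h⟩
    · exact ⟨3, Or.inr rfl, h⟩
  obtain ⟨ψ, hanti, hψ, hψ3, hψ2, hψr⟩ := hW.exists_flow t₀ m hm
  have hout : ∀ u ∈ W, ∃ β : V → ℤ,
      (∀ v ∈ nbrs G u \ W, (2 ≤ |β v| ∧ |β v| ≤ 5) ∧ B u v |β v|) ∧
      |∑ v ∈ nbrs G u ∩ W, ψ u v + ∑ v ∈ nbrs G u \ W, β v| ≤ 1 := by
    intro u hu
    rw [← nbrs_within G hu]
    have hcard : #(nbrs (within G W) u) + #(nbrs G u \ W) = 3 := by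
      rw [nbrs_within G hu, ← hG u, card_inter_add_card_sdiff]
    have hmem : ∀ v, v ∈ nbrs G u \ W ↔ G.Adj u v ∧ v ∉ W := by
      intro v
      rw [mem_sdiff, mem_nbrs]
    rcases Nat.eq_zero_or_pos #(nbrs (within G W) u) with h0 | hpos
    · obtain ⟨s, hs, k, hk, hBk, hB2⟩ : ∃ s ∈ nbrs G u \ W, ∃ k : ℤ, (3 ≤ k ∧ k ≤ 5) ∧ B u s k ∧
          ∀ v ∈ nbrs G u \ W, v ≠ s → B u v 2 := by
        by_cases hr : u = t₀ ∧ p₀ ∈ nbrs G u \ W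
        · obtain ⟨rfl, hp⟩ := hr
          rcases hm with rfl | rfl
          · obtain ⟨s, hs⟩ : ((nbrs G u \ W).erase p₀).Nonempty := by
              rw [← card_pos, card_erase_of_mem hp]
              omega
            obtain ⟨hsp, hs⟩ := mem_erase.1 hs
            obtain ⟨hs1, hs2⟩ := (hmem s).1 hs
            obtain ⟨-, k, hk, hBk⟩ := hB u hu s hs2 hs1 (Or.inr hsp)
            refine ⟨s, hs, k, hk, hBk, fun v hv _ => ?_⟩
            by_cases hvp : v = p₀
            · rw [hvp]
              exact hBm
            · obtain ⟨hv1, hv2⟩ := (hmem v).1 hv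
              exact (hB u hu v hv2 hv1 (Or.inr hvp)).1
          · refine ⟨p₀, hp, 3, by norm_num, hBm, fun v hv hvp => ?_⟩
            obtain ⟨hv1, hv2⟩ := (hmem v).1 hv
            exact (hB u hu v hv2 hv1 (Or.inr hvp)).1
        · have hflex : ∀ v ∈ nbrs G u \ W, Flexible (B u v) := by
            intro v hv
            obtain ⟨hv1, hv2⟩ := (hmem v).1 hv
            refine hB u hu v hv2 hv1 ?_
            by_contra! h
            exact hr ⟨h.1, h.2 ▸ hv⟩
          obtain ⟨s, hs⟩ : (nbrs G u \ W).Nonempty := by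
            rw [← card_pos]
            omega
          obtain ⟨-, k, hk, hBk⟩ := hflex s hs
          exact ⟨s, hs, k, hk, hBk, fun v hv _ => (hflex v hv).1⟩
      refine ⟨fun v => if v = s then -k else 2, fun v hv => ?_, ?_⟩
      · by_cases hvs : v = s
        · have : |k| = k := abs_of_nonneg (by omega)
          simp only [hvs, if_true, abs_neg, this]
          exact ⟨by omega, hBk⟩
        · simp only [hvs, if_false]
          exact ⟨by norm_num, hB2 v hv hvs⟩
      · rw [card_eq_zero.1 h0, sum_empty, zero_add, ← add_sum_erase _ _ hs, if_pos rfl]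
        have h2 : ∑ v ∈ (nbrs G u \ W).erase s, (if v = s then -k else 2) = 4 := by
          rw [sum_congr rfl fun v hv => if_neg (ne_of_mem_erase hv), sum_const,
            card_erase_of_mem hs]
          have : #(nbrs G u \ W) = 3 := by omega
          simp [this]
        rw [h2, abs_le]
        omega
    · obtain ⟨w, hw⟩ := card_pos.1 hpos
      rcases hW.card_eq (mem_nbrs.1 hw) with h | h
      · obtain ⟨p, hp⟩ := card_eq_one.1 (show #(nbrs G u \ W) = 1 by omega)
        have hpm : G.Adj u p ∧ p ∉ W := (hmem p).1 (by simp [hp])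
        have e := hψ2 u h
        obtain ⟨b, hb, hBb, hb1⟩ : ∃ b : ℤ, (2 ≤ b ∧ b ≤ 5) ∧ B u p b ∧
            |(|∑ v ∈ nbrs (within G W) u, ψ u v| - b)| ≤ 1 := by
          by_cases hr : u = t₀ ∧ p = p₀
          · obtain ⟨rfl, rfl⟩ := hr
            have e' := hψr h
            refine ⟨m, by omega, hBm, ?_⟩
            rw [abs_le]
            omega
          · obtain ⟨h2, k, hk, hBk⟩ := hB u hu p hpm.2 hpm.1 (by tauto)
            by_cases h4 : |∑ v ∈ nbrs (within G W) u, ψ u v| = 4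
            · refine ⟨k, by omega, hBk, ?_⟩
              rw [abs_le]
              omega
            · refine ⟨2, by omega, h2, ?_⟩
              rw [abs_le]
              omega
        have hbabs : |b| = b := abs_of_nonneg (by omega)
        rw [hp]
        simp only [mem_singleton, forall_eq, sum_singleton]
        rcases abs_cases (∑ v ∈ nbrs (within G W) u, ψ u v) with ⟨h1, -⟩ | ⟨h1, -⟩
        · refine ⟨fun _ => -b, ?_, ?_⟩
          · rw [abs_neg, hbabs]
            exact ⟨hb, hBb⟩
          · rwa [← sub_eq_add_neg, ← h1]
        · refine ⟨fun _ => b, ?_, ?_⟩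
          · rw [hbabs]
            exact ⟨hb, hBb⟩
          · beta_reduce
            rw [h1] at hb1
            rw [abs_le] at hb1 ⊢
            omega
      · have h0 : nbrs G u \ W = ∅ := card_eq_zero.1 (by omega)
        rw [h0]
        refine ⟨fun _ => 0, by simp, ?_⟩
        simpa using hψ3 u h
  choose! β hβ hβs using hout
  refine ⟨fun u v => if v ∈ W then ψ u v else β u v, fun u hu => ⟨fun v huv => ?_, ?_⟩⟩
  · by_cases hv : v ∈ W
    · simp only [hv, hu, if_true]
      exact ⟨hψ u v ⟨huv, hu, hv⟩, fun _ => hanti u v, fun h => absurd trivial h⟩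
    · have := hβ u hu v (mem_sdiff.2 ⟨mem_nbrs.2 huv, hv⟩)
      simp only [hv, if_false]
      exact ⟨this.1, fun h => h.elim, fun _ => this.2⟩
  · rw [← sum_inter_add_sum_sdiff (nbrs G u) W]
    convert hβs u hu using 3
    · exact sum_congr rfl fun v hv => if_pos (mem_inter.1 hv).2
    · exact sum_congr rfl fun v hv => if_neg (mem_sdiff.1 hv).2

lemma exists_flowOn {V : Type*} [Fintype V] {G : SimpleGraph V} (hG : ∀ v, #(nbrs G v) = 3)
    (n : ℕ) : ∀ (W : Finset V), #W ≤ n → ∀ (B : V → V → ℤ → Prop) (t₀ p₀ : V),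
    (∀ t ∈ W, ∀ p ∉ W, G.Adj t p → (t ≠ t₀ ∨ p ≠ p₀) → Flexible (B t p)) →
    (B t₀ p₀ 2 ∨ ∀ k, 3 ≤ k ∧ k ≤ 5 → B t₀ p₀ k) → ∃ φ, FlowOn G W B φ := by
  induction n with
  | zero =>
    intro W hW B t₀ p₀ _ _
    refine ⟨fun _ _ => 0, fun u hu => ?_⟩
    rw [card_eq_zero.1 (Nat.le_zero.1 hW)] at hu
    simp at hu
  | succ n ih =>
    intro W hW B t₀ p₀ hB hroot
    by_cases hbr : Bridgeless (within G W)
    · exact exists_flowOn_of_bridgeless hG hbr B t₀ p₀ hB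
        (hroot.imp_right fun h => h 3 (by norm_num))
    obtain ⟨X, hXW, x, hx, y, hy, hxy, hcut, ht₀⟩ : ∃ X ⊆ W, ∃ x ∈ X, ∃ y ∈ W \ X, G.Adj x y ∧
        (∀ u ∈ X, ∀ v ∈ W \ X, G.Adj u v → u = x ∧ v = y) ∧ t₀ ∉ X := by
      obtain ⟨X, hXW, x, hx, y, hy, hxy, hcut⟩ := exists_cut_edge hG hbr
      by_cases ht : t₀ ∈ X
      · have hXX : W \ (W \ X) = X := Finset.sdiff_sdiff_eq_self hXW
        refine ⟨W \ X, sdiff_subset, y, hy, x, by rwa [hXX], hxy.symm, ?_, by simp [ht]⟩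
        rw [hXX]
        exact fun u hu v hv huv => (hcut v hv u hu huv.symm).symm
      · exact ⟨X, hXW, x, hx, y, hy, hxy, hcut, ht⟩
    have hyW := mem_sdiff.1 hy
    have hcard1 : #X ≤ n := by
      have : #X < #W := card_lt_card ⟨hXW, fun h => hyW.2 (h hyW.1)⟩
      omega
    have hcard2 : #(W \ X) ≤ n := by
      have : #(W \ X) < #W :=
        card_lt_card ⟨sdiff_subset, fun h => (mem_sdiff.1 (h (hXW hx))).2 hx⟩
      omega
    have hpart : ∀ P : ℤ → Prop, (P 2 ∨ ∀ k, 3 ≤ k ∧ k ≤ 5 → P k) →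
        ∃ φ, FlowOn G X (fun t p => if p = y then P else B t p) φ := by
      intro P hP
      refine ih X hcard1 _ x y (fun t ht p hp htp hne => ?_) (by simpa using hP)
      by_cases hpW : p ∈ W
      · obtain ⟨rfl, rfl⟩ := hcut t ht p (mem_sdiff.2 ⟨hpW, hp⟩) htp
        simp at hne
      · have : p ≠ y := fun h => hpW (h ▸ hyW.1)
        simp only [this, if_false]
        exact hB t (hXW ht) p hpW htp (Or.inl fun h => ht₀ (h ▸ ht))
    obtain ⟨φ₂, hφ₂⟩ := hpart (fun k => k = 2) (Or.inl rfl)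
    obtain ⟨φ₃, hφ₃⟩ := hpart (fun k => 3 ≤ k ∧ k ≤ 5) (Or.inr fun k hk => hk)
    have h2 : |φ₂ x y| = 2 := by simpa using ((hφ₂ x hx).1 y hxy).2.2 hyW.2
    have h3 : 3 ≤ |φ₃ x y| ∧ |φ₃ x y| ≤ 5 := by simpa using ((hφ₃ x hx).1 y hxy).2.2 hyW.2
    obtain ⟨φ, hφ⟩ := ih (W \ X) hcard2
      (fun t p => if t = y ∧ p = x then (fun k => k = 2 ∨ k = |φ₃ x y|) else B t p) t₀ p₀
      (by
        intro t ht p hp htp hne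
        by_cases hyx : t = y ∧ p = x
        · simp only [hyx, and_self, if_true]
          exact ⟨Or.inl rfl, _, h3, Or.inr rfl⟩
        · simp only [hyx, if_false]
          refine hB t (mem_sdiff.1 ht).1 p (fun hpW => hyx ?_) htp hne
          have hpX : p ∈ X := by
            by_contra h
            exact hp (mem_sdiff.2 ⟨hpW, h⟩)
          exact (hcut p hpX t ht htp.symm).symm)
      (by
        by_cases hyx : t₀ = y ∧ p₀ = x
        · simp [hyx]
        · simpa only [hyx, if_false] using hroot)
    have hxW : x ∉ W \ X := fun h => (mem_sdiff.1 h).2 hx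
    have hyx : |φ y x| = 2 ∨ |φ y x| = |φ₃ x y| := by
      simpa using ((hφ y hy).1 x hxy.symm).2.2 hxW
    have hB₁ : ∀ P : ℤ → Prop, ∀ u ∈ X, ∀ v ∉ W, (if v = y then P else B u v) = B u v :=
      fun P u _ v hv => if_neg fun h : v = y => hv (h ▸ hyW.1)
    have hB₂ : ∀ P : ℤ → Prop, ∀ u ∈ W \ X, ∀ v ∉ W,
        (if u = y ∧ v = x then P else B u v) = B u v :=
      fun P u _ v hv => if_neg fun h : u = y ∧ v = x => hv (h.2 ▸ hXW hx)
    rcases hyx with h | h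
    · exact FlowOn.glue hXW hx hy hxy hcut hφ₂ hφ (hB₁ _) (hB₂ _) (h2.trans h.symm)
    · exact FlowOn.glue hXW hx hy hxy hcut hφ₃ hφ (hB₁ _) (hB₂ _) h.symm

/-- every cubic graph admits a `(3 + 1/2, 1/2)`-flow. -/
theorem stmt16 [Fintype V] (G : SimpleGraph V) (hG : IsCubic G) :
    HasFlow G (3 + 1 / 2) (1 / 2) := by
  have hG3 : ∀ v, #(nbrs G v) = 3 := by
    intro v
    rw [← hG v, ← Set.ncard_coe_finset]
    congr 1
    ext w
    simp [mem_nbrs]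
  have hφ : ∃ φ, FlowOn G univ (fun _ _ _ => True) φ := by
    rcases isEmpty_or_nonempty V with _ | ⟨⟨t⟩⟩
    · exact ⟨fun _ _ => 0, fun u => isEmptyElim u⟩
    · exact exists_flowOn hG3 _ univ le_rfl _ t t (fun _ _ p hp => absurd (mem_univ p) hp)
        (Or.inl trivial)
  obtain ⟨φ, hφ⟩ := hφ
  have hanti : ∀ u v, G.Adj u v → φ v u = -φ u v := fun u v h =>
    ((hφ u (mem_univ u)).1 v h).2.1 (mem_univ v)
  have hbd : ∀ u v, G.Adj u v → 2 ≤ |φ u v| ∧ |φ u v| ≤ 5 := fun u v h =>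
    ((hφ u (mem_univ u)).1 v h).1
  obtain ⟨D, hD⟩ : ∃ D : Orientation G, ∀ u v, D.dir u v ↔ G.Adj u v ∧ 0 < φ u v := by
    refine ⟨⟨fun u v => G.Adj u v ∧ 0 < φ u v, fun u v h => h.1, fun u v h => ?_⟩,
      fun _ _ => Iff.rfl⟩
    have hne : φ u v ≠ 0 := abs_pos.1 (by linarith [(hbd u v h).1])
    simp only [h, h.symm, true_and, hanti u v h]
    omega
  obtain ⟨f, hf⟩ : ∃ f : Sym2 V → ℝ, ∀ u v, f s(u, v) = ((|φ u v| + |φ v u| : ℤ) : ℝ) / 4 :=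
    ⟨Sym2.lift ⟨fun u v => ((|φ u v| + |φ v u| : ℤ) : ℝ) / 4, fun u v => by
      beta_reduce; rw [add_comm]⟩, fun _ _ => rfl⟩
  refine ⟨D, f, fun e => ?_, fun x => ?_⟩
  · induction e with
    | h u v =>
      intro h
      have h : G.Adj u v := h
      obtain ⟨h1, h2⟩ := hbd u v h
      rw [hf, hanti u v h, abs_neg]
      rify at h1 h2
      push_cast
      constructor <;> linarith
  · have hsum : excess D f x = ((∑ v ∈ nbrs G x, φ x v : ℤ) : ℝ) / 2 := by
      have hnb : nbrs G x = univ.filter (G.Adj x) := by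
        ext w
        simp [mem_nbrs]
      rw [excess, ← sum_sub_distrib, hnb, sum_filter, Int.cast_sum, sum_div]
      refine sum_congr rfl fun y _ => ?_
      simp only [hf, hD]
      by_cases h : G.Adj x y
      · simp only [h, h.symm, true_and, hanti x y h, abs_neg, if_true]
        rcases lt_trichotomy (φ x y) 0 with h0 | h0 | h0
        · rw [if_neg (by omega), if_pos (by omega), abs_of_neg h0]
          push_cast
          ring
        · simp [h0]
        · rw [if_pos h0, if_neg (by omega), abs_of_pos h0]
          push_cast
          ring
      · simp [h, G.adj_comm y x]
    have hx := (hφ x (mem_univ x)).2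
    rw [hsum, abs_div, abs_two, ← Int.cast_abs]
    rify at hx
    push_cast
    linarith

end BEF
end
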